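/- arXiv:2111.02944 — 2 statements merged into one kernel-verified Lean document; each statement's English description precedes it below -/
import Mathlib

section
/- Let (X,d,m) be a metric measure space satisfying CD(0,∞). Then for every Borel set Ω ⊆ X with 0 < m(Ω) < ∞, the Minkowski content satisfies m⁺(Ω) ≥ m(Ω) · h(X,d,m), where h(X,d,m) is the volume entropy. -/
open MeasureTheory Metric Filter Set

/-- L²-Wasserstein distance between two measures, via couplings. -/
noncomputable def wassersteinDist {X : Type*} [MeasurableSpace X] [PseudoEMetricSpace X]
    (μ ν : Measure X) : ENNReal :=
  (⨅ π : {π : Measure (X × X) // π.map Prod.fst = μ ∧ π.map Prod.snd = ν},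
      ∫⁻ p, edist p.1 p.2 ^ 2 ∂(π : Measure (X × X))) ^ (1/2 : ℝ)

open Classical in
/-- Relative entropy `Ent_m(μ) = ∫ ρ log ρ dm` for `μ = ρ m`; `⊤` otherwise. -/
noncomputable def relEntropy {X : Type*} [MeasurableSpace X] (m μ : Measure X) : EReal :=
  if μ ≪ m ∧ Integrable (fun x => (μ.rnDeriv m x).toReal * Real.log (μ.rnDeriv m x).toReal) m
  then ((∫ x, (μ.rnDeriv m x).toReal * Real.log (μ.rnDeriv m x).toReal ∂m : ℝ) : EReal)
  else ⊤

/-- CD(0,∞): displacement convexity of relative entropy along some W₂-geodesic. -/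
def IsCD0Infty {X : Type*} [MeasurableSpace X] [PseudoEMetricSpace X] (m : Measure X) : Prop :=
  ∀ μ₀ μ₁ : Measure X, IsProbabilityMeasure μ₀ → IsProbabilityMeasure μ₁ →
    μ₀ ≪ m → μ₁ ≪ m →
    (∀ x₀ : X, ∫⁻ x, edist x x₀ ^ 2 ∂μ₀ ≠ ⊤) →
    (∀ x₀ : X, ∫⁻ x, edist x x₀ ^ 2 ∂μ₁ ≠ ⊤) →
    ∃ μ : ℝ → Measure X, μ 0 = μ₀ ∧ μ 1 = μ₁ ∧
      (∀ t ∈ Icc (0:ℝ) 1, IsProbabilityMeasure (μ t)) ∧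
      (∀ s ∈ Icc (0:ℝ) 1, ∀ t ∈ Icc (0:ℝ) 1,
        wassersteinDist (μ s) (μ t) = ENNReal.ofReal |s - t| * wassersteinDist μ₀ μ₁) ∧
      (∀ t ∈ Icc (0:ℝ) 1,
        relEntropy m (μ t) ≤ ((1 - t : ℝ) : EReal) * relEntropy m μ₀
          + ((t : ℝ) : EReal) * relEntropy m μ₁)

/-- Minkowski content via open ε-neighbourhoods. -/
noncomputable def minkowskiContent {X : Type*} [MeasurableSpace X] [PseudoEMetricSpace X]
    (m : Measure X) (Z : Set X) : ENNReal :=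
  liminf (fun ε : ℝ => (m (Metric.thickening ε Z) - m Z) / ENNReal.ofReal ε)
    (nhdsWithin 0 (Set.Ioi 0))

/-- The set of t-intermediate points between A and B. -/
def intermediatePoints {X : Type*} [PseudoMetricSpace X] (t : ℝ) (A B : Set X) : Set X :=
  {z | ∃ x ∈ A, ∃ y ∈ B, dist z x = t * dist x y ∧ dist z y = (1 - t) * dist x y}

/-- Union of a uniformly separated family of closed sets is closed. -/
theorem isClosed_iUnion_of_forall_le_dist {X ι : Type*} [PseudoMetricSpace X] {F : ι → Set X}
    {r : ℝ} (hr : 0 < r) (hF : ∀ i, IsClosed (F i))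
    (hsep : ∀ i j, i ≠ j → ∀ x ∈ F i, ∀ y ∈ F j, r ≤ dist x y) : IsClosed (⋃ i, F i) := by
  apply LocallyFinite.isClosed_iUnion _ hF
  intro x
  refine ⟨ball x (r / 2), ball_mem_nhds x (by positivity), ?_⟩
  apply Set.Subsingleton.finite
  rintro i ⟨y, hy, hyx⟩ j ⟨z, hz, hzx⟩
  by_contra hij
  have h1 := hsep i j hij y hy z hz
  have h2 := dist_triangle_right y z x
  rw [mem_ball] at hyx hzx
  linarith

/-- On a metric space, the identity is uniformly approximated by maps all of whose preimages are
Borel. -/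
theorem exists_discrete_approximation {X : Type*} [PseudoMetricSpace X] [MeasurableSpace X]
    [BorelSpace X] {δ : ℝ} (hδ : 0 < δ) :
    ∃ q : X → X, (∀ z, dist (q z) z < δ) ∧ ∀ T : Set X, MeasurableSet (q ⁻¹' T) := by
  classical
  obtain ⟨_, hwo⟩ := exists_wellFoundedLT X
  have hne : ∀ z : X, {x : X | dist x z < δ}.Nonempty := fun z => ⟨z, by simpa using hδ⟩
  let q : X → X := fun z => (wellFounded_lt (α := X)).min {x : X | dist x z < δ} (hne z)
  have hq : ∀ z, dist (q z) z < δ := fun z => (wellFounded_lt (α := X)).min_mem _ (hne z)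
  have hmin : ∀ z x, x < q z → δ ≤ dist x z := fun z x hx => by
    by_contra h
    exact (wellFounded_lt (α := X)).not_lt_min {x : X | dist x z < δ} (not_le.1 h) hx
  refine ⟨q, hq, fun T => ?_⟩
  let F : ℕ → X → Set X := fun n x =>
    {z | dist x z ≤ δ - 1 / ((n : ℝ) + 1)} ∩ ⋂ y ∈ Iio x, {z | δ ≤ dist y z}
  have hFcl : ∀ n x, IsClosed (F n x) := fun n x =>
    (isClosed_le (by fun_prop) (by fun_prop)).inter
      (isClosed_biInter fun y _ => isClosed_le (by fun_prop) (by fun_prop))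
  have hlt : ∀ n x z x' z', z ∈ F n x → z' ∈ F n x' → x < x' → 1 / ((n : ℝ) + 1) ≤ dist z z' := by
    intro n x z x' z' hz hz' hxx
    have h1 : dist x z ≤ δ - 1 / ((n : ℝ) + 1) := hz.1
    have h2 : δ ≤ dist x z' := by
      have := hz'.2
      simp only [mem_iInter] at this
      exact this x hxx
    have := dist_triangle x z z'
    linarith
  have hU : q ⁻¹' T = ⋃ n, ⋃ x : T, F n x := by
    ext z
    simp only [mem_preimage, mem_iUnion]
    constructor
    · intro hz
      obtain ⟨n, hn⟩ := exists_nat_one_div_lt (sub_pos.2 (hq z))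
      refine ⟨n, ⟨q z, hz⟩, ?_, ?_⟩
      · show dist (q z) z ≤ _
        linarith
      · simp only [mem_iInter]
        exact fun y hy => hmin z y hy
    · rintro ⟨n, ⟨x, hx⟩, hz⟩
      have h1 : dist x z ≤ δ - 1 / ((n : ℝ) + 1) := hz.1
      have hpos : 0 < 1 / ((n : ℝ) + 1) := by positivity
      have hxz : dist x z < δ := by linarith
      have h2 : ¬ q z < x := fun h => by
        have := hz.2
        simp only [mem_iInter] at this
        have h3 : δ ≤ dist (q z) z := this (q z) h
        linarith [hq z]
      have h3 : ¬ x < q z := fun h => by linarith [hmin z x h]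
      have : q z = x := le_antisymm (not_lt.1 h3) (not_lt.1 h2)
      rwa [this]
  rw [hU]
  refine MeasurableSet.iUnion fun n => (isClosed_iUnion_of_forall_le_dist
    (F := fun x : T => F n x) (r := 1 / ((n : ℝ) + 1))
    (by positivity) (fun x => hFcl n x) ?_).measurableSet
  intro x x' hne z hz z' hz'
  rcases lt_or_gt_of_ne (Subtype.coe_ne_coe.2 hne) with h | h
  · exact hlt n x z x' z' hz hz' h
  · rw [dist_comm]; exact hlt n x' z' x z hz' hz h

/-- A set of full outer measure meets measurable sets in sets of the same outer measure. -/
theorem measure_inter_eq_of_outer_full {I : Type*} [MeasurableSpace I] {μ : Measure I}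
    [IsProbabilityMeasure μ] {E S : Set I} (hE : μ E = 1) (hS : MeasurableSet S) :
    μ (E ∩ S) = μ S := by
  refine le_antisymm (measure_mono inter_subset_right) ?_
  have h1 : μ (E ∩ S) + μ (E \ S) = 1 := by rw [measure_inter_add_sdiff E hS, hE]
  have h2 : μ S + μ Sᶜ = 1 := by rw [measure_add_measure_compl hS, measure_univ]
  have h3 : μ (E \ S) ≤ μ Sᶜ := measure_mono fun x hx => hx.2
  have h4 : μ S + μ Sᶜ ≤ μ (E ∩ S) + μ Sᶜ := by
    rw [h2, ← h1]; gcongr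
  exact (ENNReal.add_le_add_iff_right (measure_ne_top _ _)).1 h4

/-- Two probability spaces with the same image in a discrete measurable space can be glued over it:
there is a coupling charging the fibre product of any two sets of full outer measure fully. -/
theorem exists_gluing_of_discrete {I J K : Type*} [MeasurableSpace I] [MeasurableSpace J]
    (μ : Measure I) (ν : Measure J) [IsProbabilityMeasure μ] [IsProbabilityMeasure ν]
    (s : I → K) (s' : J → K) (hs : ∀ T, MeasurableSet (s ⁻¹' T))
    (hs' : ∀ T, MeasurableSet (s' ⁻¹' T)) (hss : ∀ T, μ (s ⁻¹' T) = ν (s' ⁻¹' T))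
    (E : Set I) (F : Set J) (hE : μ E = 1) (hF : ν F = 1) :
    ∃ γ : Measure (I × J), γ.map Prod.fst = μ ∧ γ.map Prod.snd = ν ∧ IsProbabilityMeasure γ ∧
      γ {p | p.1 ∈ E ∧ p.2 ∈ F ∧ s p.1 = s' p.2} = 1 := by
  classical
  let _ : MeasurableSpace K := ⊤
  have hsm : Measurable s := fun T _ => hs T
  have hsm' : Measurable s' := fun T _ => hs' T
  set Z : Set (I × J) := {p | p.1 ∈ E ∧ p.2 ∈ F ∧ s p.1 = s' p.2} with hZ
  let τ : Measure K := ν.map s'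
  have : IsProbabilityMeasure τ := Measure.isProbabilityMeasure_map hsm'.aemeasurable
  have hτμ : μ.map s = τ := by
    ext T hT
    rw [Measure.map_apply hsm hT, Measure.map_apply hsm' hT, hss]
  let g : Set J → K → ENNReal := fun T => ((ν.restrict T).map s').rnDeriv τ
  have hgm : ∀ T, Measurable (g T) := fun T => Measure.measurable_rnDeriv _ _
  have hgs : ∀ T, Measurable fun i => g T (s i) := fun T => (hgm T).comp hsm
  have hg : ∀ T H, ∫⁻ k in H, g T k ∂τ = ν (T ∩ s' ⁻¹' H) := by
    intro T H
    have hac : (ν.restrict T).map s' ≪ τ :=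
      Measure.AbsolutelyContinuous.map Measure.absolutelyContinuous_restrict hsm'
    rw [Measure.setLIntegral_rnDeriv hac, Measure.map_apply hsm' trivial,
      Measure.restrict_apply (hs' H), inter_comm]
  let c : Set I → Set J → ENNReal := fun S T => ∫⁻ i in S, g T (s i) ∂μ
  have hc_univ_left : ∀ T, c univ T = ν T := by
    intro T
    simp only [c, Measure.restrict_univ]
    rw [← lintegral_map (hgm T) hsm, hτμ, ← setLIntegral_univ, hg]
    simp
  have hg_univ : g univ =ᵐ[τ] 1 := by
    simp only [g, Measure.restrict_univ]
    exact Measure.rnDeriv_self τ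
  have hc_univ_right : ∀ S, c S univ = μ S := by
    intro S
    have : (fun i => g univ (s i)) =ᵐ[μ.restrict S] fun _ => 1 := by
      refine ae_restrict_of_ae ?_
      exact ae_of_ae_map hsm.aemeasurable (by rw [hτμ]; exact hg_univ)
    simp only [c]
    rw [lintegral_congr_ae this]
    simp
  have hcover : ∀ (S : ℕ → Set I) (T : ℕ → Set J), (∀ n, MeasurableSet (S n)) →
      (∀ n, MeasurableSet (T n)) → Z ⊆ ⋃ n, S n ×ˢ T n → 1 ≤ ∑' n, c (S n) (T n) := by
    intro S T hS hT hZc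
    let f : I → ENNReal := fun i => ∑' n, (S n).indicator (fun i => g (T n) (s i)) i
    have hfm : Measurable f := Measurable.tsum fun n =>
      (hgs (T n)).indicator (hS n)
    have hinteg : ∫⁻ i, f i ∂μ = ∑' n, c (S n) (T n) := by
      rw [lintegral_tsum fun n => ((hgs (T n)).indicator (hS n)).aemeasurable]
      exact tsum_congr fun n => lintegral_indicator (hS n) _
    have hbad : μ {i | f i < 1} = 0 := by
      have hbm : MeasurableSet {i | f i < 1} := measurableSet_lt hfm measurable_const
      rw [← measure_inter_eq_of_outer_full hE hbm]
      let H : Set K := s '' (E ∩ {i | f i < 1})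
      have hx : ∀ k : K, ∃ i : I, k ∈ H → (i ∈ E ∧ f i < 1 ∧ s i = k) := by
        intro k
        by_cases hk : k ∈ H
        · obtain ⟨i, ⟨hi, hfi⟩, hik⟩ := hk
          exact ⟨i, fun _ => ⟨hi, hfi, hik⟩⟩
        · exact ⟨(nonempty_of_isProbabilityMeasure μ).some, fun h => absurd h hk⟩
      choose x hx using hx
      let f' : K → ENNReal := fun k => ∑' n, {k | x k ∈ S n}.indicator (g (T n)) k
      have hf'm : Measurable f' := fun _ _ => trivial
      have hf'lt : ∀ k ∈ H, f' k < 1 := by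
        intro k hk
        obtain ⟨-, h2, h3⟩ := hx k hk
        have : f' k = f (x k) := tsum_congr fun n => by
          simp only [indicator, mem_ofPred_eq, h3]
        rwa [this]
      have hf'int : τ H ≤ ∫⁻ k in H, f' k ∂τ := by
        have h1 : ∫⁻ k in H, f' k ∂τ = ∑' n, ν (T n ∩ s' ⁻¹' ({k | x k ∈ S n} ∩ H)) := by
          have hm : ∀ n, AEMeasurable ({k | x k ∈ S n}.indicator (g (T n))) (τ.restrict H) :=
            fun n => Measurable.aemeasurable fun _ _ => trivial
          rw [lintegral_tsum hm]
          refine tsum_congr fun n => ?_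
          have hSn : MeasurableSet {k | x k ∈ S n} := trivial
          rw [lintegral_indicator hSn, Measure.restrict_restrict hSn, hg]
        rw [h1, Measure.map_apply hsm' trivial, ← measure_inter_eq_of_outer_full hF (hs' H)]
        refine (measure_mono ?_).trans (measure_iUnion_le _)
        rintro j ⟨hjF, hjH⟩
        obtain ⟨h1, -, h3⟩ := hx (s' j) hjH
        have hmem : (x (s' j), j) ∈ Z := ⟨h1, hjF, h3⟩
        obtain ⟨n, hn⟩ := mem_iUnion.1 (hZc hmem)
        exact mem_iUnion.2 ⟨n, hn.2, hn.1, hjH⟩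
      have hH : τ H = 0 := by
        by_contra hne
        have := setLIntegral_strict_mono (μ := τ) (s := H) (f := f') (g := fun _ => 1) trivial hne
          measurable_const (((setLIntegral_mono measurable_const
            fun k hk => (hf'lt k hk).le).trans_lt (by simp)).ne)
          (ae_of_all _ fun k hk => hf'lt k hk)
        simp only [lintegral_const, MeasurableSet.univ, Measure.restrict_apply, univ_inter,
          one_mul] at this
        exact absurd hf'int (not_le.2 this)
      rw [← hτμ, Measure.map_apply hsm trivial] at hH
      exact measure_mono_null (subset_preimage_image s _) hH
    have h1 : ∀ᵐ i ∂μ, 1 ≤ f i := by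
      rw [ae_iff]; simpa using hbad
    calc (1 : ENNReal) = ∫⁻ _, 1 ∂μ := by simp
      _ ≤ ∫⁻ i, f i ∂μ := lintegral_mono_ae h1
      _ = _ := hinteg
  let M : Set (I × J) → ENNReal := fun Q => ⨅ (R : Set I × Set J)
    (_ : MeasurableSet R.1 ∧ MeasurableSet R.2 ∧ Q ∩ Z ⊆ R.1 ×ˢ R.2), c R.1 R.2
  have hMle : ∀ Q S T, MeasurableSet S → MeasurableSet T → Q ∩ Z ⊆ S ×ˢ T → M Q ≤ c S T :=
    fun Q S T hS hT h => iInf₂_le (S, T) ⟨hS, hT, h⟩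
  have hM0 : M ∅ = 0 := by
    refine le_antisymm ((hMle ∅ ∅ ∅ .empty .empty (by simp)).trans ?_) zero_le
    simp [c]
  let o := OuterMeasure.ofFunction M hM0
  have hoZ : 1 ≤ o Z := by
    simp only [o]
    rw [OuterMeasure.ofFunction_apply]
    refine le_iInf₂ fun Q hQ => ?_
    refine ENNReal.le_of_forall_pos_le_add fun ε hε hlt => ?_
    obtain ⟨δ, hδ, hδs⟩ := ENNReal.exists_pos_sum_of_countable (ε := (ε : ENNReal))
      (by exact_mod_cast hε.ne') ℕ
    have : ∀ n, ∃ R : Set I × Set J, (MeasurableSet R.1 ∧ MeasurableSet R.2 ∧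
        Q n ∩ Z ⊆ R.1 ×ˢ R.2) ∧ c R.1 R.2 ≤ M (Q n) + δ n := by
      intro n
      have hfin : M (Q n) ≠ ⊤ := ((ENNReal.le_tsum n).trans_lt hlt).ne
      have hl : M (Q n) < M (Q n) + δ n :=
        ENNReal.lt_add_right hfin (by exact_mod_cast (hδ n).ne')
      obtain ⟨R, hR⟩ := iInf_lt_iff.1 hl
      obtain ⟨hR1, hR2⟩ := iInf_lt_iff.1 hR
      exact ⟨R, hR1, hR2.le⟩
    choose R hR hRc using this
    calc (1 : ENNReal) ≤ ∑' n, c (R n).1 (R n).2 :=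
          hcover _ _ (fun n => (hR n).1) (fun n => (hR n).2.1) fun p hp => by
            obtain ⟨n, hn⟩ := mem_iUnion.1 (hQ hp)
            exact mem_iUnion.2 ⟨n, (hR n).2.2 ⟨hn, hp⟩⟩
      _ ≤ ∑' n, (M (Q n) + δ n) := ENNReal.tsum_le_tsum hRc
      _ = ∑' n, M (Q n) + ∑' n, (δ n : ENNReal) := ENNReal.tsum_add
      _ ≤ _ := by gcongr
  have hcar : (inferInstance : MeasurableSpace (I × J)) ≤ o.caratheodory := by
    refine sup_le ?_ ?_
    · rintro _ ⟨S, hS, rfl⟩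
      refine OuterMeasure.ofFunction_caratheodory fun Q => le_iInf₂ fun R hR => ?_
      calc _ ≤ c (R.1 ∩ S) R.2 + c (R.1 \ S) R.2 := by
            refine add_le_add (hMle _ _ _ (hR.1.inter hS) hR.2.1 ?_)
              (hMle _ _ _ (hR.1.diff hS) hR.2.1 ?_)
            · rintro p ⟨⟨h1, h2⟩, h3⟩
              have := hR.2.2 ⟨h1, h3⟩
              exact ⟨⟨this.1, h2⟩, this.2⟩
            · rintro p ⟨⟨h1, h2⟩, h3⟩
              have := hR.2.2 ⟨h1, h3⟩
              exact ⟨⟨this.1, h2⟩, this.2⟩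
        _ = c R.1 R.2 := lintegral_inter_add_sdiff _ _ hS
    · rintro _ ⟨T, hT, rfl⟩
      refine OuterMeasure.ofFunction_caratheodory fun Q => le_iInf₂ fun R hR => ?_
      calc _ ≤ c R.1 (R.2 ∩ T) + c R.1 (R.2 \ T) := by
            refine add_le_add (hMle _ _ _ hR.1 (hR.2.1.inter hT) ?_)
              (hMle _ _ _ hR.1 (hR.2.1.diff hT) ?_)
            · rintro p ⟨⟨h1, h2⟩, h3⟩
              have := hR.2.2 ⟨h1, h3⟩
              exact ⟨this.1, this.2, h2⟩
            · rintro p ⟨⟨h1, h2⟩, h3⟩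
              have := hR.2.2 ⟨h1, h3⟩
              exact ⟨this.1, this.2, h2⟩
        _ = c R.1 R.2 := by
            simp only [c]
            rw [← lintegral_add_left (hgs _)]
            have hae : (fun k => g (R.2 ∩ T) k + g (R.2 \ T) k) =ᵐ[τ] g R.2 := by
              refine ae_eq_of_forall_setLIntegral_eq_of_sigmaFinite ((hgm _).add (hgm _)) (hgm _)
                fun H _ _ => ?_
              rw [lintegral_add_left (hgm _), hg, hg, hg,
                ← measure_inter_add_sdiff (R.2 ∩ s' ⁻¹' H) hT]
              congr 2 <;> (ext; simp; tauto)
            refine lintegral_congr_ae (ae_restrict_of_ae ?_)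
            exact ae_of_ae_map hsm.aemeasurable (by rw [hτμ]; exact hae)
  let γ := o.toMeasure hcar
  have hγle : ∀ S T, MeasurableSet S → MeasurableSet T → γ (S ×ˢ T) ≤ c S T := by
    intro S T hS hT
    rw [toMeasure_apply _ _ (hS.prod hT)]
    exact (OuterMeasure.ofFunction_le _).trans (hMle _ _ _ hS hT inter_subset_left)
  have hγZ : 1 ≤ γ Z := hoZ.trans (le_toMeasure_apply _ _ _)
  have hγu : γ univ = 1 := by
    refine le_antisymm ?_ (hγZ.trans (measure_mono (subset_univ _)))
    have := hγle univ univ .univ .univ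
    rwa [hc_univ_left, measure_univ, univ_prod_univ] at this
  have hγp : IsProbabilityMeasure γ := ⟨hγu⟩
  have := Measure.isProbabilityMeasure_map (μ := γ) measurable_fst.aemeasurable
  have := Measure.isProbabilityMeasure_map (μ := γ) measurable_snd.aemeasurable
  refine ⟨γ, ?_, ?_, hγp, le_antisymm prob_le_one hγZ⟩
  · refine Measure.eq_of_le_of_isProbabilityMeasure (Measure.le_iff.2 fun S hS => ?_)
    rw [Measure.map_apply measurable_fst hS, ← hc_univ_right, ← prod_univ]
    exact hγle _ _ hS .univ
  · refine Measure.eq_of_le_of_isProbabilityMeasure (Measure.le_iff.2 fun T hT => ?_)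
    rw [Measure.map_apply measurable_snd hT, ← hc_univ_left, ← univ_prod]
    exact hγle _ _ .univ hT

/-- A function exceeds a measurable minorant of the same integral by at most `η` on a set of full
outer measure. -/
theorem outer_full_le_minorant_add {I : Type*} [MeasurableSpace I] {π : Measure I}
    [IsProbabilityMeasure π] {f φ : I → ENNReal} (hφ : Measurable φ) (hle : φ ≤ f)
    (heq : ∫⁻ i, f i ∂π = ∫⁻ i, φ i ∂π) (hfin : ∫⁻ i, f i ∂π ≠ ⊤) {η : ENNReal} (hη : η ≠ 0) :
    π {i | f i ≤ φ i + η} = 1 := by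
  set G := {i | f i ≤ φ i + η} with hG
  let V := (toMeasurable π G)ᶜ
  have hV : MeasurableSet V := (measurableSet_toMeasurable π G).compl
  have h1 : ∫⁻ i, (φ i + V.indicator (fun _ => η) i) ∂π ≤ ∫⁻ i, f i ∂π := by
    refine lintegral_mono fun i => ?_
    by_cases hi : i ∈ V
    · have : i ∉ G := fun h => hi (subset_toMeasurable π G h)
      simp only [indicator_of_mem hi]
      exact (not_le.1 this).le
    · simpa [indicator_of_notMem hi] using hle i
  rw [lintegral_add_left hφ, lintegral_indicator_const hV, ← heq] at h1
  have h2 : η * π V = 0 := by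
    have : ∫⁻ i, f i ∂π + η * π V ≤ ∫⁻ i, f i ∂π + 0 := by simpa using h1
    exact le_antisymm ((ENNReal.add_le_add_iff_left hfin).1 this) zero_le
  have h3 : π V = 0 := (mul_eq_zero.1 h2).resolve_left hη
  rw [← measure_toMeasurable]
  exact (prob_compl_eq_zero_iff (measurableSet_toMeasurable π G)).1 h3

/-- The pointwise inequality behind the localisation of intermediate measures. -/
theorem sq_add_indicator_le {d P Q a b η D t ρ δ : ℝ} (ht0 : 0 < t) (ht1 : t < 1) (hη : 0 < η)
    (hD : 0 ≤ D) (hd0 : 0 ≤ d) (hdD : d ≤ D) (hP : 0 ≤ P) (hQ : 0 ≤ Q)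
    (ha : a ^ 2 ≤ P + η ^ 2) (hb : b ^ 2 ≤ Q + η ^ 2) (hd : d ≤ a + 2 * η + b)
    (hρ : t * D ≤ ρ) (hδ : δ = 0 ∨ (δ = (ρ - t * D) ^ 2 / t ∧ ρ ^ 2 ≤ P)) :
    d ^ 2 + δ ≤ P / t + Q / (1 - t) + (8 * D * η + 16 * η ^ 2) := by
  obtain ⟨p, hp, rfl⟩ : ∃ p, 0 ≤ p ∧ p ^ 2 = P := ⟨√P, Real.sqrt_nonneg _, Real.sq_sqrt hP⟩
  obtain ⟨r, hr, rfl⟩ : ∃ r, 0 ≤ r ∧ r ^ 2 = Q := ⟨√Q, Real.sqrt_nonneg _, Real.sq_sqrt hQ⟩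
  have hap : a ≤ p + η := abs_le_of_sq_le_sq' (by nlinarith) (by positivity) |>.2
  have hbr : b ≤ r + η := abs_le_of_sq_le_sq' (by nlinarith) (by positivity) |>.2
  set m := max (d - 4 * η) 0 with hm
  have hm0 : 0 ≤ m := le_max_right _ _
  have hmD : m ≤ D := max_le (by linarith) hD
  have hmpr : m ≤ p + r := max_le (by linarith) (by linarith)
  have hdm : d ≤ m + 4 * η := by linarith [le_max_left (d - 4 * η) 0]
  have h1t : 0 < 1 - t := by linarith
  have hd2 : d ^ 2 ≤ m ^ 2 + (8 * D * η + 16 * η ^ 2) := by nlinarith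
  have hpt : p ^ 2 / t = t * m ^ 2 + 2 * m * (p - t * m) + (p - t * m) ^ 2 / t := by
    field_simp; ring
  have hrt : r ^ 2 / (1 - t) = (1 - t) * m ^ 2 + 2 * m * (r - (1 - t) * m)
      + (r - (1 - t) * m) ^ 2 / (1 - t) := by
    field_simp; ring
  have hr0 : 0 ≤ (r - (1 - t) * m) ^ 2 / (1 - t) := by positivity
  have hmain : m ^ 2 + (p - t * m) ^ 2 / t ≤ p ^ 2 / t + r ^ 2 / (1 - t) := by
    rw [hpt, hrt]
    nlinarith [mul_nonneg hm0 (sub_nonneg.2 hmpr)]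
  have hδle : δ ≤ (p - t * m) ^ 2 / t := by
    rcases hδ with rfl | ⟨rfl, hρP⟩
    · positivity
    · have hρp : ρ ≤ p := abs_le_of_sq_le_sq' hρP hp |>.2
      have : t * m ≤ t * D := by gcongr
      gcongr
  linarith

/-- Optimal transport cost for the squared distance. -/
theorem wassersteinDist_sq {X : Type*} [MeasurableSpace X] [PseudoEMetricSpace X]
    (μ ν : Measure X) : wassersteinDist μ ν ^ 2 =
      ⨅ π : {π : Measure (X × X) // π.map Prod.fst = μ ∧ π.map Prod.snd = ν},
        ∫⁻ p, edist p.1 p.2 ^ 2 ∂(π : Measure (X × X)) := by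
  rw [wassersteinDist, ← ENNReal.rpow_natCast, ← ENNReal.rpow_mul]
  norm_num

theorem wassersteinDist_sq_le {X : Type*} [MeasurableSpace X] [PseudoEMetricSpace X]
    {μ ν : Measure X} (π : Measure (X × X)) (h1 : π.map Prod.fst = μ) (h2 : π.map Prod.snd = ν) :
    wassersteinDist μ ν ^ 2 ≤ ∫⁻ p, edist p.1 p.2 ^ 2 ∂π := by
  rw [wassersteinDist_sq]
  exact iInf_le_of_le ⟨π, h1, h2⟩ le_rfl

theorem exists_coupling_lt {X : Type*} [MeasurableSpace X] [PseudoEMetricSpace X]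
    {μ ν : Measure X} {c : ENNReal} (h : wassersteinDist μ ν ^ 2 < c) :
    ∃ π : Measure (X × X), π.map Prod.fst = μ ∧ π.map Prod.snd = ν ∧
      ∫⁻ p, edist p.1 p.2 ^ 2 ∂π < c := by
  rw [wassersteinDist_sq] at h
  obtain ⟨π, hπ⟩ := iInf_lt_iff.1 h
  exact ⟨π, π.2.1, π.2.2, hπ⟩

theorem isProbabilityMeasure_of_map {I J : Type*} [MeasurableSpace I] [MeasurableSpace J]
    {π : Measure I} {f : I → J} (hf : Measurable f) {μ : Measure J} [hμ : IsProbabilityMeasure μ]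
    (h : π.map f = μ) : IsProbabilityMeasure π := by
  constructor
  rw [← hμ.measure_univ, ← h, Measure.map_apply hf .univ, preimage_univ]

theorem wassersteinDist_sq_le_of_dist_le {X : Type*} [MetricSpace X] [MeasurableSpace X]
    {μ ν : Measure X} [IsProbabilityMeasure μ] [IsProbabilityMeasure ν] {A B : Set X}
    (hμA : ∀ᵐ x ∂μ, x ∈ A) (hνB : ∀ᵐ x ∂ν, x ∈ B) {D : ℝ}
    (hD : ∀ x ∈ A, ∀ y ∈ B, dist x y ≤ D) : wassersteinDist μ ν ^ 2 ≤ ENNReal.ofReal D ^ 2 := by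
  refine (wassersteinDist_sq_le (μ.prod ν) (by simp) (by simp)).trans ?_
  have h1 : ∀ᵐ p ∂(μ.prod ν), p.1 ∈ A := Measure.quasiMeasurePreserving_fst.ae hμA
  have h2 : ∀ᵐ p ∂(μ.prod ν), p.2 ∈ B := Measure.quasiMeasurePreserving_snd.ae hνB
  calc ∫⁻ p, edist p.1 p.2 ^ 2 ∂(μ.prod ν) ≤ ∫⁻ _, ENNReal.ofReal D ^ 2 ∂(μ.prod ν) := by
        refine lintegral_mono_ae ?_
        filter_upwards [h1, h2] with p hp1 hp2
        rw [edist_dist]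
        gcongr
        exact hD _ hp1 _ hp2
    _ = _ := by simp

/-- Gluing estimate: almost optimal couplings `μ₀ → ν → μ₁` force `ν` to charge the complement of
the `ρ`-neighbourhood of `A` only slightly. -/
theorem wassersteinDist_sq_add_le {X : Type*} [MetricSpace X] [MeasurableSpace X] [BorelSpace X]
    {μ₀ ν μ₁ : Measure X} [IsProbabilityMeasure μ₀] [IsProbabilityMeasure ν]
    [IsProbabilityMeasure μ₁] {A B : Set X} (hA : MeasurableSet A) (hB : MeasurableSet B)
    (hμA : ∀ᵐ x ∂μ₀, x ∈ A) (hμB : ∀ᵐ x ∂μ₁, x ∈ B) {D : ℝ} (hD0 : 0 ≤ D)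
    (hD : ∀ x ∈ A, ∀ y ∈ B, dist x y ≤ D) {t : ℝ} (ht0 : 0 < t) (ht1 : t < 1) {ρ : ℝ}
    (hρ : t * D ≤ ρ) {η : ℝ} (hη : 0 < η) {π₀ π₁ : Measure (X × X)}
    (h0f : π₀.map Prod.fst = μ₀) (h0s : π₀.map Prod.snd = ν)
    (h1f : π₁.map Prod.fst = ν) (h1s : π₁.map Prod.snd = μ₁)
    (hc0 : ∫⁻ p, edist p.1 p.2 ^ 2 ∂π₀ ≠ ⊤) (hc1 : ∫⁻ p, edist p.1 p.2 ^ 2 ∂π₁ ≠ ⊤) :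
    wassersteinDist μ₀ μ₁ ^ 2 +
        ENNReal.ofReal ((ρ - t * D) ^ 2 / t) * ν {z | ENNReal.ofReal ρ ≤ infEDist z A} ≤
      (∫⁻ p, edist p.1 p.2 ^ 2 ∂π₀) / ENNReal.ofReal t +
        (∫⁻ p, edist p.1 p.2 ^ 2 ∂π₁) / ENNReal.ofReal (1 - t) +
        ENNReal.ofReal (8 * D * η + 16 * η ^ 2) := by
  classical
  have h1t : 0 < 1 - t := by linarith
  have : IsProbabilityMeasure π₀ := isProbabilityMeasure_of_map measurable_fst h0f
  have : IsProbabilityMeasure π₁ := isProbabilityMeasure_of_map measurable_fst h1f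
  have hρ0 : 0 ≤ ρ := le_trans (by positivity) hρ
  set N : Set X := {z | ENNReal.ofReal ρ ≤ infEDist z A} with hN
  have hNm : MeasurableSet N := measurableSet_le measurable_const measurable_infEDist
  obtain ⟨φ', hφ'm, hφ'le, hφ'eq⟩ :=
    exists_measurable_le_lintegral_eq (μ := π₀) fun p => edist p.1 p.2 ^ 2
  obtain ⟨χ, hχm, hχle, hχeq⟩ :=
    exists_measurable_le_lintegral_eq (μ := π₁) fun p => edist p.1 p.2 ^ 2
  let w : X × X → ENNReal := (A ×ˢ N).indicator fun _ => ENNReal.ofReal ρ ^ 2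
  have hwm : Measurable w := measurable_const.indicator (hA.prod hNm)
  have hwle : w ≤ fun p : X × X => edist p.1 p.2 ^ 2 := by
    intro p
    by_cases hp : p ∈ A ×ˢ N
    · simp only [w, indicator_of_mem hp]
      gcongr
      rw [edist_comm]
      exact le_trans hp.2 (infEDist_le_edist_of_mem hp.1)
    · simp [w, indicator_of_notMem hp]
  let φ : X × X → ENNReal := φ' ⊔ w
  have hφm : Measurable φ := hφ'm.sup hwm
  have hφle : φ ≤ fun p : X × X => edist p.1 p.2 ^ 2 := sup_le hφ'le hwle
  have hφeq : ∫⁻ p, edist p.1 p.2 ^ 2 ∂π₀ = ∫⁻ p, φ p ∂π₀ :=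
    le_antisymm (hφ'eq.le.trans (lintegral_mono le_sup_left)) (lintegral_mono hφle)
  have hη2 : ENNReal.ofReal (η ^ 2) ≠ 0 := by simpa using hη.ne'
  have hE0 := outer_full_le_minorant_add hφm hφle hφeq hc0 hη2
  have hF0 := outer_full_le_minorant_add hχm hχle hχeq hc1 hη2
  have hinter : ∀ {π : Measure (X × X)} [IsProbabilityMeasure π] {E : Set (X × X)}
      {f : X × X → X} {S : Set X} {μ : Measure X}, π E = 1 → Measurable f → MeasurableSet S →
      π.map f = μ → (∀ᵐ x ∂μ, x ∈ S) → π (E ∩ f ⁻¹' S) = 1 := by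
    intro π _ E f S μ hE hf hS hmap hae
    rw [measure_inter_eq_of_outer_full hE (hf hS)]
    have : ∀ᵐ p ∂π, f p ∈ S := ae_of_ae_map hf.aemeasurable (hmap ▸ hae)
    exact (prob_compl_eq_zero_iff (hf hS)).1 this
  have hE1 := hinter hE0 measurable_fst hA h0f hμA
  have hF1 := hinter hF0 measurable_snd hB h1s hμB
  obtain ⟨q, hq, hqm⟩ := exists_discrete_approximation (X := X) hη
  obtain ⟨γ, hγ0, hγ1, hγp, hγZ⟩ := exists_gluing_of_discrete π₀ π₁ (fun p => q p.2)
    (fun p => q p.1) (fun T => measurable_snd (hqm T)) (fun T => measurable_fst (hqm T))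
    (fun T => by
      have h1 : π₀ (Prod.snd ⁻¹' (q ⁻¹' T)) = ν (q ⁻¹' T) := by
        rw [← h0s, Measure.map_apply measurable_snd (hqm T)]
      have h2 : π₁ (Prod.fst ⁻¹' (q ⁻¹' T)) = ν (q ⁻¹' T) := by
        rw [← h1f, Measure.map_apply measurable_fst (hqm T)]
      exact h1.trans h2.symm) _ _ hE1 hF1
  let e : (X × X) × (X × X) → X × X := fun p => (p.1.1, p.2.2)
  have hem : Measurable e := by fun_prop
  have hπ0 : (γ.map e).map Prod.fst = μ₀ := by
    rw [Measure.map_map measurable_fst hem, ← h0f, ← hγ0,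
      Measure.map_map measurable_fst measurable_fst]
    rfl
  have hπ1 : (γ.map e).map Prod.snd = μ₁ := by
    rw [Measure.map_map measurable_snd hem, ← h1s, ← hγ1,
      Measure.map_map measurable_snd measurable_snd]
    rfl
  obtain ⟨ψ, hψm, hψle, hψeq⟩ :=
    exists_measurable_le_lintegral_eq (μ := γ.map e) fun p => edist p.1 p.2 ^ 2
  set c := (ρ - t * D) ^ 2 / t with hc
  have hc_nonneg : 0 ≤ c := by positivity
  set err := 8 * D * η + 16 * η ^ 2 with herr
  have herr0 : 0 ≤ err := by positivity
  let L : (X × X) × (X × X) → ENNReal := fun p =>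
    ψ (e p) + (Prod.snd ⁻¹' N).indicator (fun _ => ENNReal.ofReal c) p.1
  let R : (X × X) × (X × X) → ENNReal := fun p =>
    φ p.1 / ENNReal.ofReal t + χ p.2 / ENNReal.ofReal (1 - t) + ENNReal.ofReal err
  have hLm : Measurable L := (hψm.comp hem).add
    ((measurable_const.indicator (measurable_snd hNm)).comp measurable_fst)
  have hRm : Measurable R := by fun_prop
  have hpt : {p : (X × X) × (X × X) |
      p.1 ∈ {i : X × X | edist i.1 i.2 ^ 2 ≤ φ i + ENNReal.ofReal (η ^ 2)} ∩ Prod.fst ⁻¹' A ∧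
      p.2 ∈ {i : X × X | edist i.1 i.2 ^ 2 ≤ χ i + ENNReal.ofReal (η ^ 2)} ∩ Prod.snd ⁻¹' B ∧
      q p.1.2 = q p.2.1} ⊆ {p | L p ≤ R p} := by
    rintro ⟨⟨x, z⟩, ⟨z', y⟩⟩ ⟨⟨hxz, hx⟩, ⟨hzy, hy⟩, hqq⟩
    replace hx : x ∈ A := hx
    replace hy : y ∈ B := hy
    replace hqq : q z = q z' := hqq
    have hφt : φ (x, z) ≠ ⊤ := ne_top_of_le_ne_top (by finiteness) (hφle (x, z))
    have hχt : χ (z', y) ≠ ⊤ := ne_top_of_le_ne_top (by finiteness) (hχle (z', y))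
    obtain ⟨P, hP, hPe⟩ : ∃ P : ℝ, 0 ≤ P ∧ φ (x, z) = ENNReal.ofReal P :=
      ⟨_, ENNReal.toReal_nonneg, (ENNReal.ofReal_toReal hφt).symm⟩
    obtain ⟨Q, hQ, hQe⟩ : ∃ Q : ℝ, 0 ≤ Q ∧ χ (z', y) = ENNReal.ofReal Q :=
      ⟨_, ENNReal.toReal_nonneg, (ENNReal.ofReal_toReal hχt).symm⟩
    have ha : dist x z ^ 2 ≤ P + η ^ 2 := by
      have : edist x z ^ 2 ≤ φ (x, z) + ENNReal.ofReal (η ^ 2) := hxz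
      rw [hPe, edist_dist, ← ENNReal.ofReal_pow dist_nonneg,
        ← ENNReal.ofReal_add hP (by positivity)] at this
      exact (ENNReal.ofReal_le_ofReal_iff (by positivity)).1 this
    have hb : dist z' y ^ 2 ≤ Q + η ^ 2 := by
      have : edist z' y ^ 2 ≤ χ (z', y) + ENNReal.ofReal (η ^ 2) := hzy
      rw [hQe, edist_dist, ← ENNReal.ofReal_pow dist_nonneg,
        ← ENNReal.ofReal_add hQ (by positivity)] at this
      exact (ENNReal.ofReal_le_ofReal_iff (by positivity)).1 this
    have hd : dist x y ≤ dist x z + 2 * η + dist z' y := by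
      have h1 := dist_triangle4 x z z' y
      have h2 := dist_triangle_left z z' (q z)
      have h3 := hq z
      have h4 := hq z'
      rw [← hqq] at h4
      linarith
    let δ : ℝ := if z ∈ N then c else 0
    have hδ : δ = 0 ∨ (δ = c ∧ ρ ^ 2 ≤ P) := by
      by_cases hz : z ∈ N
      · refine Or.inr ⟨if_pos hz, ?_⟩
        have h1 : w (x, z) ≤ φ (x, z) := le_sup_right (a := φ') (b := w) (x, z)
        have h2 : (x, z) ∈ A ×ˢ N := ⟨hx, hz⟩
        simp only [w, indicator_of_mem h2] at h1
        rw [hPe, ← ENNReal.ofReal_pow hρ0] at h1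
        exact (ENNReal.ofReal_le_ofReal_iff hP).1 h1
      · exact Or.inl (if_neg hz)
    have hδ0 : 0 ≤ δ := by rcases hδ with h | h <;> simp [h, hc_nonneg]
    have key := sq_add_indicator_le ht0 ht1 hη hD0 dist_nonneg (hD x hx y hy) hP hQ ha hb hd hρ hδ
    have hind : (Prod.snd ⁻¹' N).indicator (fun _ => ENNReal.ofReal c) (x, z) =
        ENNReal.ofReal δ := by
      by_cases hz : z ∈ N <;> simp [δ, hz]
    have hψ : ψ (x, y) ≤ ENNReal.ofReal (dist x y ^ 2) := by
      rw [ENNReal.ofReal_pow dist_nonneg, ← edist_dist]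
      exact hψle (x, y)
    calc L ((x, z), (z', y)) ≤ ENNReal.ofReal (dist x y ^ 2) + ENNReal.ofReal δ :=
          add_le_add hψ hind.le
      _ ≤ ENNReal.ofReal (P / t + Q / (1 - t) + err) := by
          rw [← ENNReal.ofReal_add (by positivity) hδ0]
          exact ENNReal.ofReal_le_ofReal key
      _ = R ((x, z), (z', y)) := by
          simp only [R]
          rw [hPe, hQe, ENNReal.ofReal_add (by positivity) herr0,
            ENNReal.ofReal_add (by positivity) (by positivity), ENNReal.ofReal_div_of_pos ht0,
            ENNReal.ofReal_div_of_pos h1t]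
  have hae : ∀ᵐ p ∂γ, L p ≤ R p := by
    have hmeas : MeasurableSet {p | L p ≤ R p} := measurableSet_le hLm hRm
    exact (prob_compl_eq_zero_iff hmeas).2
      (le_antisymm prob_le_one (hγZ.symm.le.trans (measure_mono hpt)))
  have hLint : ∫⁻ p, L p ∂γ = ∫⁻ p, ψ p ∂(γ.map e) + ENNReal.ofReal c * ν N := by
    have hsm : Measurable fun p : X × X =>
        (Prod.snd ⁻¹' N).indicator (fun _ => ENNReal.ofReal c) p :=
      measurable_const.indicator (measurable_snd hNm)
    have h1 : ∫⁻ p, (Prod.snd ⁻¹' N).indicator (fun _ => ENNReal.ofReal c) p.1 ∂γ =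
        ENNReal.ofReal c * ν N := by
      rw [← lintegral_map (f := fun p : X × X => (Prod.snd ⁻¹' N).indicator
        (fun _ => ENNReal.ofReal c) p) hsm measurable_fst, hγ0,
        lintegral_indicator_const (measurable_snd hNm), ← h0s,
        Measure.map_apply measurable_snd hNm]
    simp only [L]
    rw [lintegral_add_left (f := fun p => ψ (e p)) (hψm.comp hem), lintegral_map hψm hem, h1]
  have hRint : ∫⁻ p, R p ∂γ = (∫⁻ p, φ p ∂π₀) / ENNReal.ofReal t +
      (∫⁻ p, χ p ∂π₁) / ENNReal.ofReal (1 - t) + ENNReal.ofReal err := by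
    simp only [R, div_eq_mul_inv]
    rw [lintegral_add_left (by fun_prop), lintegral_add_left (by fun_prop),
      lintegral_mul_const _ (by fun_prop), lintegral_mul_const _ (by fun_prop),
      lintegral_const, measure_univ, mul_one, ← hγ0, ← hγ1,
      lintegral_map hφm measurable_fst, lintegral_map hχm measurable_snd]
  rw [hφeq, hχeq, ← hRint]
  refine le_trans ?_ (lintegral_mono_ae hae)
  rw [hLint, ← hψeq]
  gcongr
  exact wassersteinDist_sq_le _ hπ0 hπ1

/-- A `t`-intermediate measure between measures on `A` and `B` does not charge points far from
`A`. -/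
theorem intermediate_measure_eq_zero {X : Type*} [MetricSpace X] [MeasurableSpace X] [BorelSpace X]
    {μ₀ ν μ₁ : Measure X} [IsProbabilityMeasure μ₀] [IsProbabilityMeasure ν]
    [IsProbabilityMeasure μ₁] {A B : Set X} (hA : MeasurableSet A) (hB : MeasurableSet B)
    (hμA : ∀ᵐ x ∂μ₀, x ∈ A) (hμB : ∀ᵐ x ∂μ₁, x ∈ B) {D : ℝ} (hD0 : 0 ≤ D)
    (hD : ∀ x ∈ A, ∀ y ∈ B, dist x y ≤ D) {t : ℝ} (ht0 : 0 < t) (ht1 : t < 1) {ρ : ℝ}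
    (hρ : t * D < ρ)
    (h0 : wassersteinDist μ₀ ν = ENNReal.ofReal t * wassersteinDist μ₀ μ₁)
    (h1 : wassersteinDist ν μ₁ = ENNReal.ofReal (1 - t) * wassersteinDist μ₀ μ₁) :
    ν {z | ENNReal.ofReal ρ ≤ infEDist z A} = 0 := by
  have h1t : 0 < 1 - t := by linarith
  set N : Set X := {z | ENNReal.ofReal ρ ≤ infEDist z A} with hN
  have hWfin : wassersteinDist μ₀ μ₁ ^ 2 ≠ ⊤ :=
    ne_top_of_le_ne_top (by finiteness) (wassersteinDist_sq_le_of_dist_le hμA hμB hD)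
  set W := wassersteinDist μ₀ μ₁ with hW
  have hWt : W ≠ ⊤ := fun h => hWfin (by simp [h])
  obtain ⟨C, hC, hCe⟩ : ∃ C : ℝ, 0 ≤ C ∧ W = ENNReal.ofReal C :=
    ⟨_, ENNReal.toReal_nonneg, (ENNReal.ofReal_toReal hWt).symm⟩
  set c := (ρ - t * D) ^ 2 / t with hc
  have hcpos : 0 < c := by
    have : 0 < ρ - t * D := by linarith
    positivity
  have key : ∀ η : ℝ, 0 < η →
      ENNReal.ofReal c * ν N ≤
        ENNReal.ofReal (η / t + η / (1 - t) + (8 * D * η + 16 * η ^ 2)) := by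
    intro η hη
    have e0 : wassersteinDist μ₀ ν ^ 2 < ENNReal.ofReal ((t * C) ^ 2 + η) := by
      rw [h0, hCe, ← ENNReal.ofReal_mul ht0.le, ← ENNReal.ofReal_pow (by positivity)]
      exact (ENNReal.ofReal_lt_ofReal_iff (by positivity)).2 (by linarith)
    have e1 : wassersteinDist ν μ₁ ^ 2 < ENNReal.ofReal (((1 - t) * C) ^ 2 + η) := by
      rw [h1, hCe, ← ENNReal.ofReal_mul h1t.le, ← ENNReal.ofReal_pow (by positivity)]
      exact (ENNReal.ofReal_lt_ofReal_iff (by positivity)).2 (by linarith)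
    obtain ⟨π₀, h0f, h0s, hl0⟩ := exists_coupling_lt e0
    obtain ⟨π₁, h1f, h1s, hl1⟩ := exists_coupling_lt e1
    have := wassersteinDist_sq_add_le hA hB hμA hμB hD0 hD ht0 ht1 hρ.le hη h0f h0s h1f h1s
      hl0.ne_top hl1.ne_top
    rw [← hW, ← hN, ← hc] at this
    have h2 : W ^ 2 + ENNReal.ofReal c * ν N ≤
        W ^ 2 + ENNReal.ofReal (η / t + η / (1 - t) + (8 * D * η + 16 * η ^ 2)) := by
      calc _ ≤ _ := this
        _ ≤ ENNReal.ofReal ((t * C) ^ 2 + η) / ENNReal.ofReal t +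
            ENNReal.ofReal (((1 - t) * C) ^ 2 + η) / ENNReal.ofReal (1 - t) +
            ENNReal.ofReal (8 * D * η + 16 * η ^ 2) := by gcongr
        _ = _ := by
          rw [← ENNReal.ofReal_div_of_pos ht0, ← ENNReal.ofReal_div_of_pos h1t,
            ← ENNReal.ofReal_add (by positivity) (by positivity),
            ← ENNReal.ofReal_add (by positivity) (by positivity), hCe,
            ← ENNReal.ofReal_pow hC, ← ENNReal.ofReal_add (by positivity) (by positivity)]
          congr 1
          field_simp
          ring
    exact (ENNReal.add_le_add_iff_left hWfin).1 h2
  have hlim : Tendsto (fun η : ℝ =>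
      ENNReal.ofReal (η / t + η / (1 - t) + (8 * D * η + 16 * η ^ 2)))
      (nhdsWithin 0 (Ioi 0)) (nhds 0) := by
    have hcont : Continuous fun η : ℝ =>
        ENNReal.ofReal (η / t + η / (1 - t) + (8 * D * η + 16 * η ^ 2)) :=
      ENNReal.continuous_ofReal.comp (by fun_prop)
    have := hcont.tendsto 0
    simp only [zero_div, mul_zero, add_zero, ne_eq, OfNat.ofNat_ne_zero, not_false_eq_true,
      zero_pow, ENNReal.ofReal_zero] at this
    exact this.mono_left nhdsWithin_le_nhds
  have hle : ENNReal.ofReal c * ν N ≤ 0 :=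
    ge_of_tendsto hlim (eventually_nhdsWithin_of_forall fun η hη => key η hη)
  have hz : ENNReal.ofReal c * ν N = 0 := le_antisymm hle zero_le
  exact (mul_eq_zero.1 hz).resolve_left (by simpa using hcpos)

theorem uniform_eq_withDensity {X : Type*} [MeasurableSpace X] (m : Measure X) {A : Set X}
    (hA : MeasurableSet A) :
    (m A)⁻¹ • m.restrict A = m.withDensity (A.indicator fun _ => (m A)⁻¹) := by
  rw [withDensity_indicator hA, withDensity_const]

/-- Entropy of the uniform distribution on a set. -/
theorem relEntropy_uniform {X : Type*} [MeasurableSpace X] (m : Measure X) [SigmaFinite m]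
    {A : Set X} (hA : MeasurableSet A) (h0 : m A ≠ 0) (hfin : m A ≠ ⊤) :
    relEntropy m ((m A)⁻¹ • m.restrict A) = ((-Real.log (m A).toReal : ℝ) : EReal) := by
  rw [uniform_eq_withDensity m hA]
  set g : X → ENNReal := A.indicator fun _ => (m A)⁻¹ with hg
  have hgm : Measurable g := measurable_const.indicator hA
  have hrn : (m.withDensity g).rnDeriv m =ᵐ[m] g := Measure.rnDeriv_withDensity m hgm
  set k : ℝ := (m A).toReal⁻¹ * Real.log (m A).toReal⁻¹ with hk
  have hae : (fun x => ((m.withDensity g).rnDeriv m x).toReal *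
      Real.log ((m.withDensity g).rnDeriv m x).toReal) =ᵐ[m] A.indicator fun _ => k := by
    filter_upwards [hrn] with x hx
    rw [hx]
    by_cases hxA : x ∈ A <;> simp [hg, hxA, hk]
  have hinteg : Integrable (A.indicator fun _ => k) m :=
    (integrable_indicator_iff hA).2 (integrableOn_const hfin)
  rw [relEntropy, if_pos ⟨withDensity_absolutelyContinuous m g, hinteg.congr hae.symm⟩,
    integral_congr_ae hae, integral_indicator hA, setIntegral_const, Measure.real, smul_eq_mul, hk]
  have : (m A).toReal ≠ 0 := (ENNReal.toReal_pos h0 hfin).ne'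
  rw [mul_inv_cancel_left₀ this, Real.log_inv]

/-- Jensen's inequality for the entropy of a measure concentrated on a set of finite measure. -/
theorem neg_log_le_relEntropy {X : Type*} [MeasurableSpace X] (m : Measure X) [SigmaFinite m]
    {ν : Measure X} [IsProbabilityMeasure ν] {V : Set X} (hV : MeasurableSet V) (h0 : m V ≠ 0)
    (hfin : m V ≠ ⊤) (hνV : ν Vᶜ = 0) :
    ((-Real.log (m V).toReal : ℝ) : EReal) ≤ relEntropy m ν := by
  rw [relEntropy]
  split_ifs with h
  swap
  · exact le_top
  obtain ⟨hac, hinteg⟩ := h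
  rw [EReal.coe_le_coe_iff]
  set f : X → ℝ := fun x => (ν.rnDeriv m x).toReal with hf
  have hpos : 0 < (m V).toReal := ENNReal.toReal_pos h0 hfin
  have hfint : Integrable f m := Measure.integrable_toReal_rnDeriv
  have hfV : ∫ x in V, f x ∂m = 1 := by
    rw [hf, Measure.setIntegral_toReal_rnDeriv hac, Measure.real, (prob_compl_eq_zero_iff hV).1 hνV,
      ENNReal.toReal_one]
  have hfVc : ∀ᵐ x ∂m, x ∉ V → f x = 0 := by
    have h1 : ∫⁻ x in Vᶜ, ν.rnDeriv m x ∂m = 0 := by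
      rw [Measure.setLIntegral_rnDeriv hac, hνV]
    rw [lintegral_eq_zero_iff (Measure.measurable_rnDeriv ν m)] at h1
    filter_upwards [(ae_restrict_iff' hV.compl).1 h1] with x hx hxV
    simp [hf, hx hxV]
  have hpt : ∀ y : ℝ, 0 ≤ y → y * (-Real.log (m V).toReal + 1) - (m V).toReal⁻¹ ≤
      y * Real.log y := by
    intro y hy
    rcases hy.eq_or_lt with rfl | hy
    · simp [hpos.le]
    · have h1 := Real.log_le_sub_one_of_pos (x := (m V).toReal⁻¹ / y) (by positivity)
      rw [Real.log_div (by positivity) hy.ne', Real.log_inv] at h1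
      have h2 := mul_le_mul_of_nonneg_left h1 hy.le
      have h3 : y * ((m V).toReal⁻¹ / y - 1) = (m V).toReal⁻¹ - y := by field_simp
      rw [h3] at h2
      linarith
  have hsupp : ∫ x, f x * Real.log (f x) ∂m = ∫ x in V, f x * Real.log (f x) ∂m := by
    rw [← integral_indicator hV]
    refine integral_congr_ae ?_
    filter_upwards [hfVc] with x hx
    by_cases hxV : x ∈ V
    · simp [hxV]
    · simp [hxV, hx hxV]
  have hconst : IntegrableOn (fun _ : X => (m V).toReal⁻¹) V m := integrableOn_const hfin
  calc -Real.log (m V).toReal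
      = ∫ x in V, (f x * (-Real.log (m V).toReal + 1) - (m V).toReal⁻¹) ∂m := by
        rw [integral_sub (hfint.integrableOn.mul_const _) hconst, integral_mul_const, hfV,
          setIntegral_const, Measure.real, smul_eq_mul, mul_inv_cancel₀ hpos.ne']
        ring
    _ ≤ ∫ x in V, f x * Real.log (f x) ∂m :=
        integral_mono ((hfint.integrableOn.mul_const _).sub hconst) hinteg.integrableOn
          fun x => hpt _ ENNReal.toReal_nonneg
    _ = _ := hsupp.symm

/-- Brunn–Minkowski type inequality under `CD(0,∞)`. -/
theorem IsCD0Infty.log_measure_thickening_ge {X : Type*} [MetricSpace X] [MeasurableSpace X]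
    [BorelSpace X] {m : Measure X} [SigmaFinite m] (hCD : IsCD0Infty m) {A B : Set X}
    (hA : MeasurableSet A) (hB : MeasurableSet B) (hAb : Bornology.IsBounded A)
    (hBb : Bornology.IsBounded B) (hA0 : m A ≠ 0) (hAfin : m A ≠ ⊤) (hB0 : m B ≠ 0)
    (hBfin : m B ≠ ⊤) {D : ℝ} (hD0 : 0 ≤ D) (hD : ∀ x ∈ A, ∀ y ∈ B, dist x y ≤ D) {t : ℝ}
    (ht0 : 0 < t) (ht1 : t < 1) {ρ : ℝ} (hρ : t * D < ρ) (hfin : m (thickening ρ A) ≠ ⊤) :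
    (1 - t) * Real.log (m A).toReal + t * Real.log (m B).toReal ≤
      Real.log (m (thickening ρ A)).toReal := by
  have hprob : ∀ {S : Set X}, m S ≠ 0 → m S ≠ ⊤ →
      IsProbabilityMeasure ((m S)⁻¹ • m.restrict S) := fun h0 hf =>
    ⟨by simp [ENNReal.inv_mul_cancel h0 hf]⟩
  have hac : ∀ S : Set X, (m S)⁻¹ • m.restrict S ≪ m := fun S =>
    Measure.absolutelyContinuous_restrict.smul_left _
  have hmem : ∀ {S : Set X}, MeasurableSet S → ∀ᵐ x ∂((m S)⁻¹ • m.restrict S), x ∈ S :=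
    fun hS => Measure.ae_smul_measure (ae_restrict_mem hS) _
  have hmom : ∀ {S : Set X}, MeasurableSet S → Bornology.IsBounded S → m S ≠ 0 → m S ≠ ⊤ →
      ∀ x₀ : X, ∫⁻ x, edist x x₀ ^ 2 ∂((m S)⁻¹ • m.restrict S) ≠ ⊤ := by
    intro S hS hSb h0 hf x₀
    have := hprob h0 hf
    obtain ⟨r, hr⟩ := hSb.subset_closedBall x₀
    have h1 : ∫⁻ x, edist x x₀ ^ 2 ∂((m S)⁻¹ • m.restrict S) ≤
        ∫⁻ _, ENNReal.ofReal r ^ 2 ∂((m S)⁻¹ • m.restrict S) := by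
      refine lintegral_mono_ae ?_
      filter_upwards [hmem hS] with x hx
      rw [edist_dist]
      gcongr
      exact hr hx
    refine ne_top_of_le_ne_top ?_ h1
    rw [lintegral_const, measure_univ, mul_one]
    finiteness
  have := hprob hA0 hAfin
  have := hprob hB0 hBfin
  obtain ⟨μ, hμ0, hμ1, hμp, hμW, hμE⟩ := hCD _ _ (hprob hA0 hAfin) (hprob hB0 hBfin) (hac A)
    (hac B) (hmom hA hAb hA0 hAfin) (hmom hB hBb hB0 hBfin)
  have ht : t ∈ Icc (0 : ℝ) 1 := ⟨ht0.le, ht1.le⟩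
  have := hμp t ht
  have hW0 := hμW 0 (by simp) t ht
  have hW1 := hμW t ht 1 (by simp)
  rw [hμ0, zero_sub, abs_neg, abs_of_pos ht0] at hW0
  rw [hμ1, abs_sub_comm, abs_of_pos (sub_pos.2 ht1)] at hW1
  have hzero := intermediate_measure_eq_zero hA hB (hmem hA) (hmem hB) hD0 hD ht0 ht1 hρ hW0 hW1
  have hρ0 : 0 < ρ := lt_of_le_of_lt (by positivity) hρ
  have hcompl : (thickening ρ A)ᶜ = {z | ENNReal.ofReal ρ ≤ infEDist z A} := by
    ext z
    simp [thickening]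
  have hV0 : m (thickening ρ A) ≠ 0 := fun h =>
    hA0 (measure_mono_null (self_subset_thickening hρ0 A) h)
  have hlow := neg_log_le_relEntropy m (ν := μ t) isOpen_thickening.measurableSet hV0 hfin
    (hcompl ▸ hzero)
  have hle := hlow.trans (hμE t ht)
  rw [relEntropy_uniform m hA hA0 hAfin, relEntropy_uniform m hB hB0 hBfin, ← EReal.coe_mul,
    ← EReal.coe_mul, ← EReal.coe_add, EReal.coe_le_coe_iff] at hle
  linarith

/-- Exponential growth of balls propagates to neighbourhoods of bounded sets. -/
theorem IsCD0Infty.measure_thickening_ge {X : Type*} [MetricSpace X] [MeasurableSpace X]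
    [BorelSpace X] {m : Measure X} (hCD : IsCD0Infty m) (hball : ∀ (x : X) (r : ℝ), m (ball x r) ≠ ⊤)
    {x₀ : X} {k : ℝ} (hk : ∀ᶠ r : ℝ in atTop, k < Real.log (m (ball x₀ r)).toReal / r)
    (hk0 : 0 ≤ k) {A : Set X} (hA : MeasurableSet A) {n : ℝ} (hn : 0 ≤ n) (hAn : A ⊆ ball x₀ n)
    (hA0 : m A ≠ 0) {ε : ℝ} (hε : 0 < ε) :
    m A * ENNReal.ofReal (1 + ε * k) ≤ m (thickening ε A) := by
  have : SigmaFinite m := by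
    refine ⟨⟨⟨fun i => ball x₀ i, fun _ => trivial, fun i => (hball _ _).lt_top, ?_⟩⟩⟩
    exact iUnion_ball_nat x₀
  have hAb : Bornology.IsBounded A := isBounded_ball.subset hAn
  have hAfin : m A ≠ ⊤ := measure_ne_top_of_subset hAn (hball _ _)
  have hVfin : m (thickening ε A) ≠ ⊤ := by
    obtain ⟨r, hr⟩ := hAb.thickening (δ := ε) |>.subset_ball x₀
    exact measure_ne_top_of_subset hr (hball _ _)
  have hApos : 0 < (m A).toReal := ENNReal.toReal_pos hA0 hAfin
  have hVpos : 0 < (m (thickening ε A)).toReal :=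
    ENNReal.toReal_pos (fun h => hA0 (measure_mono_null (self_subset_thickening hε A) h)) hVfin
  have hstep : ∀ ε' : ℝ, 0 < ε' → ε' < ε →
      Real.log (m A).toReal + ε' * k ≤ Real.log (m (thickening ε A)).toReal := by
    intro ε' hε' hlt
    have hev : ∀ᶠ R : ℝ in atTop, (1 - ε' / (R + n)) * Real.log (m A).toReal +
        (ε' - n * (ε' / (R + n))) * k ≤ Real.log (m (thickening ε A)).toReal := by
      filter_upwards [hk, eventually_gt_atTop ε'] with R hR hRε
      have hR0 : 0 < R := hε'.trans hRε
      have hRn : 0 < R + n := by linarith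
      have hlog : R * k < Real.log (m (ball x₀ R)).toReal := by
        rw [lt_div_iff₀ hR0] at hR
        linarith
      have hB0 : m (ball x₀ R) ≠ 0 := by
        intro h
        rw [h] at hlog
        simp only [ENNReal.toReal_zero, Real.log_zero] at hlog
        exact absurd hlog (not_lt.2 (by positivity))
      have ht0 : 0 < ε' / (R + n) := by positivity
      have h := hCD.log_measure_thickening_ge hA measurableSet_ball hAb isBounded_ball hA0 hAfin hB0
        (hball x₀ R) (D := R + n) hRn.le (fun x hx y hy => by
          have h1 := dist_triangle_right x y x₀
          have h2 := mem_ball.1 (hAn hx)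
          have h3 := mem_ball.1 hy
          linarith) (t := ε' / (R + n)) ht0 ((div_lt_one hRn).2 (by linarith)) (ρ := ε)
        (by rwa [div_mul_cancel₀ _ hRn.ne']) hVfin
      have h4 : ε' - n * (ε' / (R + n)) = ε' / (R + n) * R := by field_simp; ring
      rw [h4, mul_assoc]
      have := mul_le_mul_of_nonneg_left hlog.le ht0.le
      linarith
    have hz : Tendsto (fun R : ℝ => ε' / (R + n)) atTop (nhds 0) :=
      tendsto_const_nhds.div_atTop (tendsto_atTop_add_const_right _ _ tendsto_id)
    have hlim : Tendsto (fun R : ℝ => (1 - ε' / (R + n)) * Real.log (m A).toReal +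
        (ε' - n * (ε' / (R + n))) * k) atTop
        (nhds ((1 - 0) * Real.log (m A).toReal + (ε' - n * 0) * k)) :=
      ((tendsto_const_nhds.sub hz).mul_const _).add
        ((tendsto_const_nhds.sub (hz.const_mul n)).mul_const k)
    have := le_of_tendsto hlim hev
    simpa using this
  have hlog : Real.log (m A).toReal + ε * k ≤ Real.log (m (thickening ε A)).toReal := by
    have hlim : Tendsto (fun ε' : ℝ => Real.log (m A).toReal + ε' * k) (nhdsWithin ε (Iio ε))
        (nhds (Real.log (m A).toReal + ε * k)) :=
      ((continuous_const.add (continuous_id.mul continuous_const)).tendsto ε).mono_left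
        nhdsWithin_le_nhds
    refine le_of_tendsto hlim ?_
    filter_upwards [Ioo_mem_nhdsLT hε] with ε' h
    exact hstep ε' h.1 h.2
  have hreal : (m A).toReal * (1 + ε * k) ≤ (m (thickening ε A)).toReal := by
    calc (m A).toReal * (1 + ε * k) ≤ (m A).toReal * Real.exp (ε * k) := by
          gcongr
          linarith [Real.add_one_le_exp (ε * k)]
      _ = Real.exp (Real.log (m A).toReal + ε * k) := by rw [Real.exp_add, Real.exp_log hApos]
      _ ≤ Real.exp (Real.log (m (thickening ε A)).toReal) := Real.exp_le_exp.2 hlog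
      _ = _ := Real.exp_log hVpos
  rw [← ENNReal.ofReal_toReal hAfin, ← ENNReal.ofReal_mul hApos.le]
  exact ENNReal.ofReal_le_of_le_toReal hreal

/-- sharp isoperimetric inequality `m⁺(Ω) ≥ m(Ω)·h(X,d,m)` under CD(0,∞). -/
theorem isoperimetric_volume_entropy
    {X : Type*} [MetricSpace X] [MeasurableSpace X] [BorelSpace X]
    (m : Measure X) (hCD : IsCD0Infty m) (h : ENNReal)
    (hent : ∀ x₀ : X, Tendsto
      (fun r : ℝ => ((Real.log (m (ball x₀ r)).toReal / r : ℝ) : EReal)) atTop (nhds (h : EReal)))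
    (Ω : Set X) (hΩ : MeasurableSet Ω) (h0 : 0 < m Ω) (hfin : m Ω ≠ ⊤) :
    m Ω * h ≤ minkowskiContent m Ω := by
  rw [mul_comm, ← ENNReal.le_div_iff_mul_le (Or.inl h0.ne') (Or.inl hfin)]
  refine le_of_forall_lt_imp_le_of_dense fun k' hk' => ?_
  rw [ENNReal.le_div_iff_mul_le (Or.inl h0.ne') (Or.inl hfin), mul_comm]
  obtain ⟨k, hk0, rfl⟩ : ∃ k : ℝ, 0 ≤ k ∧ k' = ENNReal.ofReal k :=
    ⟨_, ENNReal.toReal_nonneg, (ENNReal.ofReal_toReal hk'.ne_top).symm⟩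
  have hk : ∀ x₀ : X, ∀ᶠ r : ℝ in atTop, k < Real.log (m (ball x₀ r)).toReal / r := by
    intro x₀
    have hlt : ((k : ℝ) : EReal) < (h : EReal) := by
      have := EReal.coe_ennreal_lt_coe_ennreal_iff.2 hk'
      rwa [EReal.coe_ennreal_ofReal, max_eq_left hk0] at this
    filter_upwards [(hent x₀).eventually (lt_mem_nhds hlt)] with r hr
    exact EReal.coe_lt_coe_iff.1 hr
  have hball : ∀ (x : X) (r : ℝ), m (ball x r) ≠ ⊤ := by
    intro x r
    obtain ⟨R, hR, hRr, hR0⟩ :=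
      ((hk x).and ((eventually_ge_atTop r).and (eventually_gt_atTop 0))).exists
    have hRfin : m (ball x R) ≠ ⊤ := by
      intro htop
      rw [htop] at hR
      simp only [ENNReal.toReal_top, Real.log_zero, zero_div] at hR
      exact absurd hR (not_lt.2 hk0)
    exact measure_ne_top_of_subset (ball_subset_ball hRr) hRfin
  obtain ⟨x₀, -⟩ := nonempty_of_measure_ne_zero h0.ne'
  have hmono : Monotone fun n : ℕ => Ω ∩ ball x₀ n := fun i j hij =>
    inter_subset_inter_right _ (ball_subset_ball (Nat.cast_le.2 hij))
  have hunion : ⋃ n : ℕ, Ω ∩ ball x₀ n = Ω := by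
    rw [← inter_iUnion, iUnion_ball_nat, inter_univ]
  have hgrow : ∀ ε : ℝ, 0 < ε → m Ω * ENNReal.ofReal (1 + ε * k) ≤ m (thickening ε Ω) := by
    intro ε hε
    have hlim : Tendsto (fun n : ℕ => m (Ω ∩ ball x₀ n) * ENNReal.ofReal (1 + ε * k)) atTop
        (nhds (m Ω * ENNReal.ofReal (1 + ε * k))) := by
      have := tendsto_measure_iUnion_atTop (μ := m) hmono
      rw [hunion] at this
      exact ENNReal.Tendsto.mul_const this (Or.inr ENNReal.ofReal_ne_top)
    refine le_of_tendsto' hlim fun n => ?_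
    by_cases hn : m (Ω ∩ ball x₀ n) = 0
    · simp [hn]
    · exact (hCD.measure_thickening_ge hball (hk x₀) hk0 (hΩ.inter measurableSet_ball)
        n.cast_nonneg inter_subset_right hn hε).trans
        (measure_mono (thickening_subset_of_subset ε inter_subset_left))
  refine le_liminf_of_le (by isBoundedDefault) (eventually_nhdsWithin_of_forall fun ε hε => ?_)
  replace hε : 0 < ε := hε
  rw [ENNReal.le_div_iff_mul_le (Or.inl (by simpa using hε)) (Or.inl ENNReal.ofReal_ne_top)]
  refine ENNReal.le_sub_of_add_le_left hfin ((le_of_eq ?_).trans (hgrow ε hε))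
  rw [ENNReal.ofReal_add zero_le_one (by positivity), ENNReal.ofReal_mul hε.le, ENNReal.ofReal_one]
  ring
end

section
/- Let (X,d,m) be a metric measure space satisfying CD(0,∞) with m(B_r(x₀)) finite for all r > 0. Then the limit lim_{r→∞} (ln m(B_r(x₀)))/r exists in [0,∞] and its value is independent of the choice of base point x₀ ∈ X. -/
open MeasureTheory Metric Filter Set

/-- Every metric space admits, at each scale, a map with small fibres all of whose preimages are
Borel (a weak form of Stone's paracompactness theorem). -/
theorem exists_small_fibers_forall_measurableSet {X : Type*} [MetricSpace X] [MeasurableSpace X]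
    [BorelSpace X] {ε : ℝ} (hε : 0 < ε) :
    ∃ p : X → X, (∀ J : Set X, MeasurableSet (p ⁻¹' J)) ∧ ∀ x, dist x (p x) < ε := by
  classical
  let : LinearOrder X := WellOrderingRel.isWellOrder.linearOrder
  have : WellFoundedLT X := ⟨WellOrderingRel.isWellOrder.wf⟩
  have hne (x : X) : {s | dist x s < ε}.Nonempty := ⟨x, by simpa using hε⟩
  let p : X → X := fun x => wellFounded_lt.min {s | dist x s < ε} (hne x)
  have hp (x : X) : dist x (p x) < ε := wellFounded_lt.min_mem _ (hne x)
  have hmin (x s : X) (h : s < p x) : ε ≤ dist x s := by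
    by_contra! hlt
    exact wellFounded_lt.not_lt_min {s | dist x s < ε} hlt h
  refine ⟨p, fun J => ?_, hp⟩
  let F : ℕ → Set X := fun n => {x | p x ∈ J ∧ dist x (p x) ≤ ε - 1 / (n + 1 : ℝ)}
  have hF : p ⁻¹' J = ⋃ n, F n := by
    ext x
    simp only [mem_preimage, mem_iUnion, F, mem_ofPred_eq, exists_and_left]
    refine ⟨fun h => ⟨h, ?_⟩, fun h => h.1⟩
    obtain ⟨n, hn⟩ := exists_nat_one_div_lt (sub_pos.2 (hp x))
    exact ⟨n, by linarith⟩
  rw [hF]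
  refine MeasurableSet.iUnion fun n => IsClosed.measurableSet ?_
  have hδ : (0 : ℝ) < 1 / (n + 1 : ℝ) := by positivity
  set δ : ℝ := 1 / (n + 1 : ℝ)
  have hsep : ∀ x ∈ F n, ∀ y ∈ F n, dist x y < δ → p x = p y := by
    intro x hx y hy hxy
    by_contra hne
    rcases lt_or_gt_of_ne hne with h | h
    · have := hmin y (p x) h
      have h2 := dist_triangle y x (p x)
      rw [dist_comm y x] at h2
      linarith [hx.2]
    · have := hmin x (p y) h
      have h2 := dist_triangle x y (p y)
      linarith [hy.2]
  refine isClosed_of_closure_subset fun x hx => ?_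
  rw [Metric.mem_closure_iff] at hx
  obtain ⟨y, hy, hxy⟩ := hx (δ / 2) (by positivity)
  have hnear : ∀ z ∈ F n, dist x z < δ / 2 → p z = p y := fun z hz hxz =>
    hsep z hz y hy (by linarith [dist_triangle_left z y x])
  have hle : dist x (p y) ≤ ε - δ := by
    refine le_of_forall_pos_lt_add fun η hη => ?_
    obtain ⟨z, hz, hxz⟩ := hx (min (δ / 2) η) (by positivity)
    have h1 := hnear z hz (hxz.trans_le (min_le_left _ _))
    have h2 := hz.2
    rw [h1] at h2
    linarith [dist_triangle x z (p y), min_le_right (δ / 2) η]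
  have hpx : p x = p y := by
    refine le_antisymm ?_ ?_
    · by_contra! h
      linarith [hmin x (p y) h]
    · by_contra! h
      obtain ⟨z, hz, hxz⟩ := hx (min (δ / 2) (ε - dist x (p x)))
        (lt_min (by positivity) (sub_pos.2 (hp x)))
      have h1 := hnear z hz (hxz.trans_le (min_le_left _ _))
      have h2 := hmin z (p x) (h1 ▸ h)
      have h3 := dist_triangle_left z (p x) x
      linarith [min_le_right (δ / 2) (ε - dist x (p x))]
  exact ⟨hpx ▸ hy.1, hpx ▸ hle⟩

open ProbabilityTheory in
/-- If the conditioning variable takes values in a space all of whose subsets are measurable, then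
almost every conditional law gives full outer measure to the corresponding fibre. -/
theorem ae_condDistrib_image_fiber_eq_one {Ω I S : Type*} [MeasurableSpace Ω] [MeasurableSpace I]
    [DiscreteMeasurableSpace I] [TopologicalSpace S] [PolishSpace S] [MeasurableSpace S]
    [BorelSpace S] [Nonempty S] {P : Measure Ω} [IsProbabilityMeasure P] {q : Ω → I}
    (hq : Measurable q) {c : Ω → S} (hc : Measurable c) {O : Set Ω} (hO : P O = 1) :
    ∀ᵐ i ∂(P.map q), condDistrib c q P i (c '' (O ∩ q ⁻¹' {i})) = 1 := by
  set κ := condDistrib c q P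
  have hex (i : I) : ∃ H : Set S, IsOpen H ∧ c '' (O ∩ q ⁻¹' {i}) ⊆ H ∧
      (κ i H = 1 → κ i (c '' (O ∩ q ⁻¹' {i})) = 1) := by
    by_cases h : κ i (c '' (O ∩ q ⁻¹' {i})) < 1
    · obtain ⟨H, h1, h2, h3⟩ := Set.exists_isOpen_lt_of_lt _ _ h
      exact ⟨H, h2, h1, fun h4 => absurd h4 h3.ne⟩
    · exact ⟨univ, isOpen_univ, subset_univ _, fun _ => le_antisymm prob_le_one (not_lt.1 h)⟩
  choose H hopen hsub himp using hex
  let T : Set (I × S) := {x | x.2 ∈ H x.1}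
  have hT : MeasurableSet T := by
    have hb := TopologicalSpace.isBasis_countableBasis S
    have : T = ⋃ U ∈ TopologicalSpace.countableBasis S, {i | U ⊆ H i} ×ˢ U := by
      ext ⟨i, s⟩
      simp only [T, mem_ofPred_eq, mem_iUnion, mem_prod, exists_prop]
      constructor
      · intro h
        obtain ⟨U, hU, hs, hUH⟩ := hb.exists_subset_of_mem_open h (hopen i)
        exact ⟨U, hU, hUH, hs⟩
      · rintro ⟨U, -, hUH, hs⟩
        exact hUH hs
    rw [this]
    refine MeasurableSet.biUnion (TopologicalSpace.countable_countableBasis S) fun U hU => ?_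
    exact (MeasurableSet.of_discrete).prod (hb.isOpen hU).measurableSet
  have h1 : (P.map fun a => (q a, c a)) T = 1 := by
    rw [Measure.map_apply (hq.prodMk hc) hT]
    refine le_antisymm prob_le_one (hO ▸ measure_mono fun w hw => ?_)
    exact hsub (q w) ⟨w, ⟨hw, rfl⟩, rfl⟩
  have : IsProbabilityMeasure (P.map q) := Measure.isProbabilityMeasure_map hq.aemeasurable
  rw [← compProd_map_condDistrib hc.aemeasurable, Measure.compProd_apply hT] at h1
  have hm : Measurable fun i => κ i (Prod.mk i ⁻¹' T) := Measurable.of_discrete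
  have h2 : ∀ᵐ i ∂(P.map q), κ i (Prod.mk i ⁻¹' T) = 1 := by
    have h3 : (fun i => κ i (Prod.mk i ⁻¹' T)) =ᵐ[P.map q] fun _ => 1 := by
      refine ae_eq_of_ae_le_of_lintegral_le (ae_of_all _ fun i => prob_le_one) ?_
        aemeasurable_const ?_
      · rw [h1]; simp
      · rw [h1]; simp
    exact h3
  filter_upwards [h2] with i hi using himp i hi

open ProbabilityTheory in
/-- The conditional law of `c` given `q`, evaluated on a set `B`, is the Radon–Nikodym derivative
of the law of `q` restricted to the event `c ∈ B`. -/
theorem condDistrib_ae_eq_rnDeriv {Ω I S : Type*} [MeasurableSpace Ω] [MeasurableSpace I]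
    [MeasurableSpace S] [StandardBorelSpace S] [Nonempty S] {P : Measure Ω}
    [IsProbabilityMeasure P] {q : Ω → I} (hq : Measurable q) {c : Ω → S} (hc : Measurable c)
    {B : Set S} (hB : MeasurableSet B) :
    (fun i => condDistrib c q P i B) =ᵐ[P.map q]
      ((P.restrict (c ⁻¹' B)).map q).rnDeriv (P.map q) := by
  have : IsProbabilityMeasure (P.map q) := Measure.isProbabilityMeasure_map hq.aemeasurable
  have hmeas : Measurable fun i => condDistrib c q P i B := Kernel.measurable_coe _ hB
  have h : (P.restrict (c ⁻¹' B)).map q = (P.map q).withDensity fun i => condDistrib c q P i B := by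
    ext J hJ
    rw [Measure.map_apply hq hJ, Measure.restrict_apply (hq hJ), withDensity_apply _ hJ,
      ← Measure.compProd_apply_prod hJ hB, compProd_map_condDistrib hc.aemeasurable,
      Measure.map_apply (hq.prodMk hc) (hJ.prod hB)]
    rfl
  rw [h]
  exact (Measure.rnDeriv_withDensity _ hmeas).symm

/-- The density, with respect to the law of `q`, of the law of `q` restricted to the event `A`;
that is, the conditional probability of `A` given `q`. -/
noncomputable def condMass {Ω I : Type*} [MeasurableSpace Ω] [MeasurableSpace I]
    (P : Measure Ω) (q : Ω → I) (A : Set Ω) : I → ENNReal :=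
  ((P.restrict A).map q).rnDeriv (P.map q)

open Classical in
/-- The membership pattern of a point with respect to a family of sets. -/
noncomputable def membershipCode {ι Ω : Type*} (A : ι → Set Ω) (w : Ω) : ι → Bool :=
  fun s => decide (w ∈ A s)

theorem membershipCode_eq_true {ι Ω : Type*} (A : ι → Set Ω) (w : Ω) (s : ι) :
    membershipCode A w s = true ↔ w ∈ A s := by
  simp [membershipCode]

theorem membershipCode_preimage {ι Ω : Type*} (A : ι → Set Ω) (s : ι) :
    membershipCode A ⁻¹' {x | x s = true} = A s := by
  ext w
  exact membershipCode_eq_true A w s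

theorem measurable_membershipCode {ι Ω : Type*} [MeasurableSpace Ω] {A : ι → Set Ω}
    (hA : ∀ s, MeasurableSet (A s)) : Measurable (membershipCode A) := by
  refine measurable_pi_lambda _ fun s => ?_
  refine measurable_to_bool ?_
  convert hA s using 1
  ext w
  exact membershipCode_eq_true A w s

theorem measurableSet_eval_eq_true {ι : Type*} (s : ι) :
    MeasurableSet {x : ι → Bool | x s = true} :=
  (measurable_pi_apply s : Measurable fun x : ι → Bool => x s) (measurableSet_singleton true)

/-- A measurable set that misses a set of full outer measure is null. -/
theorem measure_eq_zero_of_disjoint_full {S : Type*} [MeasurableSpace S] {μ : Measure S}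
    [IsProbabilityMeasure μ] {R E : Set S} (hR : μ R = 1) (hE : MeasurableSet E)
    (h : ∀ x ∈ R, x ∉ E) : μ E = 0 := by
  rw [← prob_compl_eq_one_iff hE]
  exact le_antisymm prob_le_one (hR ▸ measure_mono fun x hx => h x hx)

open ProbabilityTheory in
/-- Countably many measurable rectangles in the gluing of two probability spaces over a common
discrete factor can be modelled by a genuine measure on a space of codes. -/
theorem exists_code_measure {ι Ω₁ Ω₂ I : Type*} [Countable ι] [MeasurableSpace Ω₁]
    [MeasurableSpace Ω₂] [MeasurableSpace I] [DiscreteMeasurableSpace I]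
    (P₁ : Measure Ω₁) (P₂ : Measure Ω₂) [IsProbabilityMeasure P₁] [IsProbabilityMeasure P₂]
    {q₁ : Ω₁ → I} {q₂ : Ω₂ → I} (hq₁ : Measurable q₁) (hq₂ : Measurable q₂)
    (hU : P₁.map q₁ = P₂.map q₂) {A : ι → Set Ω₁} {B : ι → Set Ω₂}
    (hA : ∀ s, MeasurableSet (A s)) (hB : ∀ s, MeasurableSet (B s)) :
    ∃ Q : Measure ((ι → Bool) × (ι → Bool)),
      (∀ s, Q {x | x.1 s = true ∧ x.2 s = true} =
        ∫⁻ i, condMass P₁ q₁ (A s) i * condMass P₂ q₂ (B s) i ∂(P₁.map q₁)) ∧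
      ∀ O₁ O₂, P₁ O₁ = 1 → P₂ O₂ = 1 → ∀ E, MeasurableSet E →
        (∀ w ∈ O₁, ∀ w' ∈ O₂, q₁ w = q₂ w' →
          (membershipCode A w, membershipCode B w') ∉ E) → Q E = 0 := by
  have : PolishSpace Bool := inferInstance
  set c₁ := membershipCode A
  set c₂ := membershipCode B
  have hc₁ : Measurable c₁ := measurable_membershipCode hA
  have hc₂ : Measurable c₂ := measurable_membershipCode hB
  set κ₁ := condDistrib c₁ q₁ P₁
  set κ₂ := condDistrib c₂ q₂ P₂
  have hQ (E : Set ((ι → Bool) × (ι → Bool))) (hE : MeasurableSet E) :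
      (P₁.map q₁).bind (fun i => (κ₁ i).prod (κ₂ i)) E
        = ∫⁻ i, (κ₁ i).prod (κ₂ i) E ∂(P₁.map q₁) :=
    Measure.bind_apply hE Measurable.of_discrete.aemeasurable
  refine ⟨(P₁.map q₁).bind fun i => (κ₁ i).prod (κ₂ i), fun s => ?_, ?_⟩
  · have hset : {x : (ι → Bool) × (ι → Bool) | x.1 s = true ∧ x.2 s = true}
        = {x | x s = true} ×ˢ {x | x s = true} := rfl
    rw [hset, hQ _ ((measurableSet_eval_eq_true s).prod (measurableSet_eval_eq_true s))]
    have h1 := condDistrib_ae_eq_rnDeriv (P := P₁) hq₁ hc₁ (measurableSet_eval_eq_true s)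
    have h2 := condDistrib_ae_eq_rnDeriv (P := P₂) hq₂ hc₂ (measurableSet_eval_eq_true s)
    rw [← hU] at h2
    refine lintegral_congr_ae ?_
    filter_upwards [h1, h2] with i hi1 hi2
    rw [Measure.prod_prod, hi1, hi2, membershipCode_preimage, membershipCode_preimage]
    simp only [condMass, hU]
  · intro O₁ O₂ hO₁ hO₂ E hE hdisj
    rw [hQ E hE, lintegral_eq_zero_iff Measurable.of_discrete]
    have h1 := ae_condDistrib_image_fiber_eq_one hq₁ hc₁ hO₁
    have h2 := ae_condDistrib_image_fiber_eq_one hq₂ hc₂ hO₂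
    rw [← hU] at h2
    filter_upwards [h1, h2] with i hi1 hi2
    change (κ₁ i).prod (κ₂ i) E = 0
    rw [Measure.prod_apply hE, lintegral_eq_zero_iff (measurable_measure_prodMk_left hE)]
    have hm : MeasurableSet {ω | κ₂ i (Prod.mk ω ⁻¹' E) = 0} :=
      measurable_measure_prodMk_left hE (measurableSet_singleton 0)
    refine measure_eq_zero_of_disjoint_full hi1 hm.compl ?_
    rintro _ ⟨w, ⟨hw, hwi⟩, rfl⟩
    rw [notMem_compl_iff]
    refine measure_eq_zero_of_disjoint_full hi2 (measurable_prodMk_left hE) ?_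
    rintro _ ⟨w', ⟨hw', hwi'⟩, rfl⟩
    exact hdisj w hw w' hw' (hwi.trans hwi'.symm)

/-- The measurable rectangles of a product. -/
def measurableRectangles (Ω₁ Ω₂ : Type*) [MeasurableSpace Ω₁] [MeasurableSpace Ω₂] :
    Set (Set (Ω₁ × Ω₂)) :=
  image2 (· ×ˢ ·) {A | MeasurableSet A} {B | MeasurableSet B}

theorem isSetSemiring_measurableRectangles (Ω₁ Ω₂ : Type*) [MeasurableSpace Ω₁]
    [MeasurableSpace Ω₂] : IsSetSemiring (measurableRectangles Ω₁ Ω₂) where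
  empty_mem := ⟨∅, MeasurableSet.empty, ∅, MeasurableSet.empty, by simp⟩
  inter_mem := by
    rintro _ ⟨A, hA, B, hB, rfl⟩ _ ⟨A', hA', B', hB', rfl⟩
    exact ⟨A ∩ A', hA.inter hA', B ∩ B', hB.inter hB', prod_inter_prod.symm⟩
  sdiff_eq_sUnion' := by
    classical
    rintro _ ⟨A, hA, B, hB, rfl⟩ _ ⟨A', hA', B', hB', rfl⟩
    refine ⟨{(A \ A') ×ˢ B, (A ∩ A') ×ˢ (B \ B')}, ?_, ?_, ?_⟩
    · intro s hs
      simp only [Finset.coe_insert, Finset.coe_singleton, mem_insert_iff, mem_singleton_iff] at hs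
      rcases hs with rfl | rfl
      · exact ⟨_, hA.diff hA', _, hB, rfl⟩
      · exact ⟨_, hA.inter hA', _, hB.diff hB', rfl⟩
    · rw [Finset.coe_insert, Finset.coe_singleton]
      have hd : Disjoint ((A \ A') ×ˢ B) ((A ∩ A') ×ˢ (B \ B')) :=
        disjoint_left.2 fun x hx hx' => hx.1.2 hx'.1.2
      exact pairwise_pair.2 fun _ => ⟨hd, hd.symm⟩
    · ext ⟨x, y⟩
      simp only [Set.mem_sdiff, mem_prod, Finset.coe_insert, Finset.coe_singleton, sUnion_insert,
        sUnion_singleton, mem_union, mem_inter_iff]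
      tauto

theorem measurableSet_image_of_mem_measurableRectangles {Ω₁ Ω₂ : Type*} [MeasurableSpace Ω₁]
    [MeasurableSpace Ω₂] {s : Set (Ω₁ × Ω₂)} (hs : s ∈ measurableRectangles Ω₁ Ω₂) :
    MeasurableSet (Prod.fst '' s) ∧ MeasurableSet (Prod.snd '' s) ∧
      s = (Prod.fst '' s) ×ˢ (Prod.snd '' s) := by
  obtain ⟨A, hA, B, hB, rfl⟩ := hs
  rcases eq_empty_or_nonempty A with rfl | hAne
  · simp
  rcases eq_empty_or_nonempty B with rfl | hBne
  · simp
  rw [fst_image_prod _ hBne, snd_image_prod hAne]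
  exact ⟨hA, hB, rfl⟩

/-- The total mass of the rectangle `s` in the gluing of `P₁` and `P₂` which makes the coordinates
conditionally independent given the common value of `q₁` and `q₂`. -/
noncomputable def glueMass {Ω₁ Ω₂ I : Type*} [MeasurableSpace Ω₁] [MeasurableSpace Ω₂]
    [MeasurableSpace I] (P₁ : Measure Ω₁) (P₂ : Measure Ω₂) (q₁ : Ω₁ → I) (q₂ : Ω₂ → I)
    (s : Set (Ω₁ × Ω₂)) : ENNReal :=
  ∫⁻ i, condMass P₁ q₁ (Prod.fst '' s) i * condMass P₂ q₂ (Prod.snd '' s) i ∂(P₁.map q₁)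

theorem exists_code_measure_rectangles {ι Ω₁ Ω₂ I : Type*} [Countable ι] [MeasurableSpace Ω₁]
    [MeasurableSpace Ω₂] [MeasurableSpace I] [DiscreteMeasurableSpace I]
    (P₁ : Measure Ω₁) (P₂ : Measure Ω₂) [IsProbabilityMeasure P₁] [IsProbabilityMeasure P₂]
    {q₁ : Ω₁ → I} {q₂ : Ω₂ → I} (hq₁ : Measurable q₁) (hq₂ : Measurable q₂)
    (hU : P₁.map q₁ = P₂.map q₂) {S : ι → Set (Ω₁ × Ω₂)}
    (hS : ∀ s, S s ∈ measurableRectangles Ω₁ Ω₂) :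
    ∃ (Q : Measure ((ι → Bool) × (ι → Bool))) (T : ι → Set ((ι → Bool) × (ι → Bool)))
      (c : Ω₁ × Ω₂ → (ι → Bool) × (ι → Bool)),
      (∀ s, MeasurableSet (T s)) ∧ (∀ s w, c w ∈ T s ↔ w ∈ S s) ∧
      (∀ s, Q (T s) = glueMass P₁ P₂ q₁ q₂ (S s)) ∧
      ∀ O₁ O₂, P₁ O₁ = 1 → P₂ O₂ = 1 → ∀ E, MeasurableSet E →
        (∀ w ∈ O₁, ∀ w' ∈ O₂, q₁ w = q₂ w' → c (w, w') ∉ E) → Q E = 0 := by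
  have h s := measurableSet_image_of_mem_measurableRectangles (hS s)
  obtain ⟨Q, hQ1, hQ2⟩ := exists_code_measure P₁ P₂ hq₁ hq₂ hU
    (A := fun s => Prod.fst '' S s) (B := fun s => Prod.snd '' S s)
    (fun s => (h s).1) (fun s => (h s).2.1)
  refine ⟨Q, fun s => {x | x.1 s = true ∧ x.2 s = true}, fun w =>
    (membershipCode (fun s => Prod.fst '' S s) w.1, membershipCode (fun s => Prod.snd '' S s) w.2),
    fun s => (measurableSet_eval_eq_true s).prod (measurableSet_eval_eq_true s), fun s w => ?_,
    hQ1, hQ2⟩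
  simp only [mem_ofPred_eq, membershipCode_eq_true]
  nth_rw 3 [(h s).2.2]
  rw [mem_prod]

theorem condMass_univ {Ω I : Type*} [MeasurableSpace Ω] [MeasurableSpace I] (P : Measure Ω)
    [IsProbabilityMeasure P] {q : Ω → I} (hq : Measurable q) : condMass P q univ =ᵐ[P.map q] 1 := by
  have : IsProbabilityMeasure (P.map q) := Measure.isProbabilityMeasure_map hq.aemeasurable
  rw [condMass, Measure.restrict_univ]
  exact Measure.rnDeriv_self _

theorem lintegral_condMass {Ω I : Type*} [MeasurableSpace Ω] [MeasurableSpace I]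
    (P : Measure Ω) [IsProbabilityMeasure P] {q : Ω → I} (hq : Measurable q) {A : Set Ω} :
    ∫⁻ i, condMass P q A i ∂(P.map q) = P A := by
  have : IsProbabilityMeasure (P.map q) := Measure.isProbabilityMeasure_map hq.aemeasurable
  have hac : (P.restrict A).map q ≪ P.map q :=
    Measure.restrict_le_self.absolutelyContinuous.map hq
  rw [condMass, Measure.lintegral_rnDeriv hac, Measure.map_apply hq MeasurableSet.univ,
    preimage_univ, Measure.restrict_apply_univ]

section Gluing

variable {Ω₁ Ω₂ I : Type*} [MeasurableSpace Ω₁] [MeasurableSpace Ω₂] [MeasurableSpace I]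
  [DiscreteMeasurableSpace I] (P₁ : Measure Ω₁) (P₂ : Measure Ω₂) [IsProbabilityMeasure P₁]
  [IsProbabilityMeasure P₂] {q₁ : Ω₁ → I} {q₂ : Ω₂ → I}

theorem glueMass_le_tsum (hq₁ : Measurable q₁) (hq₂ : Measurable q₂)
    (hU : P₁.map q₁ = P₂.map q₂) {O₁ : Set Ω₁} {O₂ : Set Ω₂} (hO₁ : P₁ O₁ = 1) (hO₂ : P₂ O₂ = 1)
    {s : Set (Ω₁ × Ω₂)} (hs : s ∈ measurableRectangles Ω₁ Ω₂) {f : ℕ → Set (Ω₁ × Ω₂)}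
    (hf : ∀ n, f n ∈ measurableRectangles Ω₁ Ω₂)
    (hcov : ∀ w ∈ O₁, ∀ w' ∈ O₂, q₁ w = q₂ w' → (w, w') ∈ s → (w, w') ∈ ⋃ n, f n) :
    glueMass P₁ P₂ q₁ q₂ s ≤ ∑' n, glueMass P₁ P₂ q₁ q₂ (f n) := by
  obtain ⟨Q, T, c, hT, hc, hQ, hnull⟩ := exists_code_measure_rectangles P₁ P₂ hq₁ hq₂ hU
    (S := fun o : Option ℕ => o.elim s f) (by rintro (_ | n); exacts [hs, hf n])
  have h0 : Q (T none \ ⋃ n, T (some n)) = 0 := by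
    refine hnull O₁ O₂ hO₁ hO₂ _ ((hT _).diff (MeasurableSet.iUnion fun n => hT _)) ?_
    intro w hw w' hw' hww' hmem
    obtain ⟨n, hn⟩ := mem_iUnion.1 (hcov w hw w' hw' hww' ((hc none _).1 hmem.1))
    exact hmem.2 (mem_iUnion.2 ⟨n, (hc (some n) _).2 hn⟩)
  calc glueMass P₁ P₂ q₁ q₂ s = Q (T none) := (hQ none).symm
    _ ≤ Q (⋃ n, T (some n)) := measure_mono_ae (ae_le_set.2 h0)
    _ ≤ ∑' n, Q (T (some n)) := measure_iUnion_le _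
    _ = ∑' n, glueMass P₁ P₂ q₁ q₂ (f n) := by simp only [hQ, Option.elim_some]

open Classical in
theorem glueMass_sUnion (hq₁ : Measurable q₁) (hq₂ : Measurable q₂)
    (hU : P₁.map q₁ = P₂.map q₂) (J : Finset (Set (Ω₁ × Ω₂)))
    (hJ : (J : Set (Set (Ω₁ × Ω₂))) ⊆ measurableRectangles Ω₁ Ω₂)
    (hdis : (J : Set (Set (Ω₁ × Ω₂))).PairwiseDisjoint id)
    (hmem : ⋃₀ (J : Set (Set (Ω₁ × Ω₂))) ∈ measurableRectangles Ω₁ Ω₂) :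
    glueMass P₁ P₂ q₁ q₂ (⋃₀ J) = ∑ u ∈ J, glueMass P₁ P₂ q₁ q₂ u := by
  obtain ⟨Q, T, c, hT, hc, hQ, hnull⟩ := exists_code_measure_rectangles P₁ P₂ hq₁ hq₂ hU
    (S := fun o : Option J => o.elim (⋃₀ J) Subtype.val)
    (by rintro (_ | u); exacts [hmem, hJ u.2])
  have hnull' (E) (hE : MeasurableSet E) (h : ∀ w, c w ∉ E) : Q E = 0 :=
    hnull univ univ measure_univ measure_univ E hE fun w _ w' _ _ => h (w, w')
  have heq : T none =ᵐ[Q] ⋃ u ∈ (Finset.univ : Finset J), T (some u) := by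
    have hTu : MeasurableSet (⋃ u ∈ (Finset.univ : Finset J), T (some u)) :=
      Finset.measurableSet_biUnion _ fun u _ => hT _
    rw [ae_eq_set]
    refine ⟨hnull' _ ((hT _).diff hTu) fun w hw => ?_, hnull' _ (hTu.diff (hT _)) fun w hw => ?_⟩
    · obtain ⟨u, hu, hwu⟩ := (hc none w).1 hw.1
      exact hw.2 (mem_iUnion₂.2 ⟨⟨u, hu⟩, Finset.mem_univ _, (hc (some ⟨u, hu⟩) w).2 hwu⟩)
    · obtain ⟨u, -, hwu⟩ := mem_iUnion₂.1 hw.1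
      exact hw.2 ((hc none w).2 ⟨u.1, u.2, (hc (some u) w).1 hwu⟩)
  have hd : ((Finset.univ : Finset J) : Set J).Pairwise
      (Function.onFun (AEDisjoint Q) fun u => T (some u)) := by
    intro u _ v _ huv
    refine hnull' _ ((hT _).inter (hT _)) fun w hw => ?_
    exact disjoint_left.1 (hdis u.2 v.2 fun h => huv (Subtype.ext h))
      ((hc (some u) w).1 hw.1) ((hc (some v) w).1 hw.2)
  calc glueMass P₁ P₂ q₁ q₂ (⋃₀ J) = Q (T none) := (hQ none).symm
    _ = Q (⋃ u ∈ (Finset.univ : Finset J), T (some u)) := measure_congr heq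
    _ = ∑ u : J, Q (T (some u)) :=
      measure_biUnion_finset₀ hd fun u _ => (hT _).nullMeasurableSet
    _ = ∑ u : J, glueMass P₁ P₂ q₁ q₂ u := by simp only [hQ, Option.elim_some]
    _ = ∑ u ∈ J, glueMass P₁ P₂ q₁ q₂ u := Finset.sum_coe_sort J _

/-- Gluing of two probability measures along discrete observables with the same law. No
separability is assumed, and the gluing charges only pairs of points in prescribed (possibly
non-measurable) sets of full outer measure on which the observables agree. -/
theorem exists_gluing (hq₁ : Measurable q₁) (hq₂ : Measurable q₂)
    (hU : P₁.map q₁ = P₂.map q₂) :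
    ∃ Γ : Measure (Ω₁ × Ω₂), IsProbabilityMeasure Γ ∧ Γ.map Prod.fst = P₁ ∧ Γ.map Prod.snd = P₂ ∧
      ∀ O₁ O₂, P₁ O₁ = 1 → P₂ O₂ = 1 → ∀ E, MeasurableSet E →
        (∀ w ∈ O₁, ∀ w' ∈ O₂, q₁ w = q₂ w' → (w, w') ∈ E) → ∀ᵐ w ∂Γ, w ∈ E := by
  have hC := isSetSemiring_measurableRectangles Ω₁ Ω₂
  have : Nonempty Ω₁ := nonempty_of_isProbabilityMeasure P₁
  have : Nonempty Ω₂ := nonempty_of_isProbabilityMeasure P₂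
  have h0 : glueMass P₁ P₂ q₁ q₂ ∅ = 0 := by
    refine le_antisymm ?_ bot_le
    have h := glueMass_sUnion P₁ P₂ hq₁ hq₂ hU ∅ (by simp) (by simp) (by simpa using hC.empty_mem)
    simpa using h.le
  let m : AddContent ENNReal (measurableRectangles Ω₁ Ω₂) :=
    { toFun := glueMass P₁ P₂ q₁ q₂
      empty' := h0
      sUnion' := glueMass_sUnion P₁ P₂ hq₁ hq₂ hU }
  have hgen : (Prod.instMeasurableSpace : MeasurableSpace (Ω₁ × Ω₂))
      = MeasurableSpace.generateFrom (measurableRectangles Ω₁ Ω₂) := generateFrom_prod.symm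
  have hsub : m.IsSigmaSubadditive := fun f hf hfU =>
    glueMass_le_tsum P₁ P₂ hq₁ hq₂ hU measure_univ measure_univ hfU hf fun _ _ _ _ _ h => h
  have hΓ (s) (hs : s ∈ measurableRectangles Ω₁ Ω₂) :
      m.measure hC hgen.le hsub s = glueMass P₁ P₂ q₁ q₂ s := m.measure_eq hC hgen hsub hs
  have h1 (A : Set Ω₁) (hA : MeasurableSet A) :
      glueMass P₁ P₂ q₁ q₂ (A ×ˢ univ) = P₁ A := by
    rcases eq_empty_or_nonempty A with rfl | hne
    · rw [empty_prod, measure_empty]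
      exact h0
    rw [glueMass, fst_image_prod _ univ_nonempty, snd_image_prod hne, ← lintegral_condMass P₁ hq₁]
    refine lintegral_congr_ae ?_
    have h := condMass_univ P₂ hq₂
    rw [← hU] at h
    filter_upwards [h] with i hi
    rw [hi, Pi.one_apply, mul_one]
  have h2 (B : Set Ω₂) (hB : MeasurableSet B) :
      glueMass P₁ P₂ q₁ q₂ (univ ×ˢ B) = P₂ B := by
    rcases eq_empty_or_nonempty B with rfl | hne
    · rw [prod_empty, measure_empty]
      exact h0
    rw [glueMass, fst_image_prod _ hne, snd_image_prod univ_nonempty, ← lintegral_condMass P₂ hq₂,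
      ← hU]
    refine lintegral_congr_ae ?_
    filter_upwards [condMass_univ P₁ hq₁] with i hi
    rw [hi, Pi.one_apply, one_mul]
  have huniv : glueMass P₁ P₂ q₁ q₂ univ = 1 := by
    rw [← univ_prod_univ, h1 _ MeasurableSet.univ, measure_univ]
  have hunivmem : univ ∈ measurableRectangles Ω₁ Ω₂ :=
    ⟨univ, MeasurableSet.univ, univ, MeasurableSet.univ, univ_prod_univ⟩
  have hprob : IsProbabilityMeasure (m.measure hC hgen.le hsub) :=
    ⟨by rw [hΓ _ hunivmem, huniv]⟩
  refine ⟨m.measure hC hgen.le hsub, hprob, ?_, ?_, ?_⟩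
  · ext A hA
    rw [Measure.map_apply measurable_fst hA, ← prod_univ,
      hΓ _ ⟨A, hA, univ, MeasurableSet.univ, rfl⟩, h1 A hA]
  · ext B hB
    rw [Measure.map_apply measurable_snd hB, ← univ_prod,
      hΓ _ ⟨univ, MeasurableSet.univ, B, hB, rfl⟩, h2 B hB]
  · intro O₁ O₂ hO₁ hO₂ E hE hOE
    have hle : 1 ≤ m.measure hC hgen.le hsub E := by
      refine le_trans (b := inducedOuterMeasure (fun x _ => m x) hC.empty_mem addContent_empty E)
        ?_ (le_trim (μ := m.measureCaratheodory hC hsub) _)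
      rw [inducedOuterMeasure, OuterMeasure.ofFunction_apply]
      refine le_iInf₂ fun f hf => ?_
      by_cases hfm : ∀ n, f n ∈ measurableRectangles Ω₁ Ω₂
      · simp only [extend_eq _ (hfm _)]
        rw [← huniv]
        exact glueMass_le_tsum P₁ P₂ hq₁ hq₂ hU hO₁ hO₂ hunivmem hfm
          fun w hw w' hw' hww' _ => hf (hOE w hw w' hw' hww')
      · push Not at hfm
        obtain ⟨n, hn⟩ := hfm
        refine le_trans ?_ (ENNReal.le_tsum n)
        rw [extend, iInf_neg hn]
        exact le_top
    exact (mem_ae_iff_prob_eq_one hE).2 (le_antisymm prob_le_one hle)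

end Gluing

/-- The infimum of the quadratic cost over all couplings, i.e. the square of the Wasserstein
distance. -/
noncomputable def transportCost {X : Type*} [MeasurableSpace X] [PseudoEMetricSpace X]
    (μ ν : Measure X) : ENNReal :=
  ⨅ π : {π : Measure (X × X) // π.map Prod.fst = μ ∧ π.map Prod.snd = ν},
    ∫⁻ p, edist p.1 p.2 ^ 2 ∂(π : Measure (X × X))

/-- A function with finite lower integral is, up to `ε`, bounded by a measurable minorant with the
same integral on a set of full outer measure. -/
theorem exists_measurable_minorant_full {Ω : Type*} [MeasurableSpace Ω] {P : Measure Ω}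
    [IsProbabilityMeasure P] {f : Ω → ENNReal} (hf : ∫⁻ x, f x ∂P ≠ ⊤) {ε : ENNReal} (hε : ε ≠ 0) :
    ∃ g : Ω → ENNReal, Measurable g ∧ g ≤ f ∧ ∫⁻ x, g x ∂P = ∫⁻ x, f x ∂P ∧
      P {x | f x ≤ g x + ε} = 1 := by
  obtain ⟨g, hg, hgf, heq⟩ := exists_measurable_le_lintegral_eq P f
  refine ⟨g, hg, hgf, heq.symm, ?_⟩
  set T := toMeasurable P {x | f x ≤ g x + ε}
  have hT : MeasurableSet T := measurableSet_toMeasurable _ _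
  have hle : ∀ x, g x + Tᶜ.indicator (fun _ => ε) x ≤ f x := by
    intro x
    by_cases hx : x ∈ T
    · simpa [hx] using hgf x
    · rw [indicator_of_mem (show x ∈ Tᶜ from hx)]
      have : x ∉ {x | f x ≤ g x + ε} := fun h => hx (subset_toMeasurable _ _ h)
      exact (not_le.1 this).le
  have h := lintegral_mono (μ := P) hle
  rw [lintegral_add_left hg, lintegral_indicator_const hT.compl, heq] at h
  have h0 : ε * P Tᶜ = 0 := by
    have h' : ∫⁻ x, g x ∂P + ε * P Tᶜ ≤ ∫⁻ x, g x ∂P + 0 := by rwa [add_zero]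
    exact le_antisymm ((ENNReal.add_le_add_iff_left (heq ▸ hf)).1 h') bot_le
  rw [← measure_toMeasurable, ← prob_compl_eq_zero_iff hT]
  exact (mul_eq_zero.1 h0).resolve_left hε

theorem add_sq_le_sq_div_add_sq_div {a b e t : ℝ} (ht0 : 0 < t) (ht1 : t < 1) (he : 0 ≤ e)
    (h : e ≤ a + b) : e ^ 2 ≤ a ^ 2 / t + b ^ 2 / (1 - t) := by
  have h1 : 0 < 1 - t := by linarith
  have h2 : a ^ 2 / t + b ^ 2 / (1 - t) =
      (a + b) ^ 2 + ((1 - t) * a - t * b) ^ 2 / (t * (1 - t)) := by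
    field_simp
    ring
  have h3 : 0 ≤ ((1 - t) * a - t * b) ^ 2 / (t * (1 - t)) := by positivity
  rw [h2]
  nlinarith [pow_le_pow_left₀ he h 2]

theorem sq_add_sq_le_sq_div_add_sq_div {a b e t η : ℝ} (ht0 : 0 < t) (ht1 : t < 1) (he : 0 ≤ e)
    (hη : 0 ≤ η) (h : e ≤ a + b) (ha : t * e + η ≤ a) :
    e ^ 2 + η ^ 2 ≤ a ^ 2 / t + b ^ 2 / (1 - t) := by
  have h1 : 0 < 1 - t := by linarith
  have ha0 : 0 ≤ a := by nlinarith
  rcases le_total a e with hae | hae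
  · have h2 : (e - a) ^ 2 ≤ b ^ 2 := pow_le_pow_left₀ (by linarith) (by linarith) 2
    have h3 : a ^ 2 / t + (e - a) ^ 2 / (1 - t) = e ^ 2 + (a - t * e) ^ 2 / (t * (1 - t)) := by
      field_simp
      ring
    have h4 : η ^ 2 ≤ (a - t * e) ^ 2 / (t * (1 - t)) := by
      rw [le_div_iff₀ (by positivity)]
      have h5 : η ^ 2 ≤ (a - t * e) ^ 2 := pow_le_pow_left₀ hη (by linarith) 2
      nlinarith [sq_nonneg η, mul_pos ht0 h1, sq_nonneg t]
    have h6 : (e - a) ^ 2 / (1 - t) ≤ b ^ 2 / (1 - t) := by gcongr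
    linarith
  · have h2 : e ^ 2 + η ^ 2 ≤ a ^ 2 / t := by
      rw [le_div_iff₀ ht0]
      rcases le_total e (t * e + η) with h3 | h3
      · nlinarith [pow_le_pow_left₀ (by positivity : 0 ≤ t * e + η) ha 2,
          mul_nonneg ht0.le (mul_nonneg he hη), mul_nonneg (mul_nonneg ht0.le he) (sub_nonneg.2 h3),
          mul_nonneg h1.le (sq_nonneg η)]
      · have h4 : η ^ 2 ≤ ((1 - t) * e) ^ 2 := pow_le_pow_left₀ hη (by linarith) 2
        have h5 := pow_le_pow_left₀ he hae 2
        nlinarith [mul_le_mul_of_nonneg_left h4 ht0.le, mul_nonneg h1.le (sq_nonneg e),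
          mul_pos ht0 h1, mul_nonneg (mul_nonneg h1.le h1.le) (sq_nonneg e)]
    have h3 : 0 ≤ b ^ 2 / (1 - t) := by positivity
    linarith

theorem sq_add_le {b ε : ℝ} (hε : 0 ≤ ε) : (b + ε) ^ 2 ≤ (1 + ε) * b ^ 2 + ε * (1 + ε) := by
  nlinarith [mul_nonneg hε (sq_nonneg (b - 1))]

/-- The pointwise inequality behind the uniqueness of midpoints at the level of distances: if `z`
is far from the centre of a ball containing `x`, then the broken path from `x` to `z` and from a
point near `z` to `y` has an excess of energy. -/
theorem sq_dist_add_indicator_le {X : Type*} [PseudoMetricSpace X] {x₀ x y z z' : X}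
    {r R t η ε : ℝ} (ht0 : 0 < t) (ht1 : t < 1) (hη : 0 ≤ η) (hε : 0 ≤ ε) (hx : x ∈ ball x₀ r)
    (hy : y ∈ ball x₀ R) (hz : dist z z' ≤ ε) :
    dist x y ^ 2 + {z | r + t * (R + r) + η ≤ dist z x₀}.indicator (fun _ => η ^ 2) z ≤
      1 / t * dist x z ^ 2 + (1 + ε) / (1 - t) * dist z' y ^ 2 + ε * (1 + ε) / (1 - t) := by
  have h1 : 0 < 1 - t := by linarith
  rw [mem_ball] at hx hy
  have hb : dist z y ≤ dist z' y + ε := by linarith [dist_triangle z z' y]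
  have hb2 : dist z y ^ 2 / (1 - t) ≤
      (1 + ε) / (1 - t) * dist z' y ^ 2 + ε * (1 + ε) / (1 - t) := by
    have h2 := (pow_le_pow_left₀ dist_nonneg hb 2).trans (sq_add_le hε)
    calc dist z y ^ 2 / (1 - t)
        ≤ ((1 + ε) * dist z' y ^ 2 + ε * (1 + ε)) / (1 - t) := by gcongr
      _ = _ := by ring
  have hxy : dist x y ≤ R + r := by linarith [dist_triangle_right x y x₀]
  suffices h : dist x y ^ 2 + {z | r + t * (R + r) + η ≤ dist z x₀}.indicator (fun _ => η ^ 2) z ≤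
      dist x z ^ 2 / t + dist z y ^ 2 / (1 - t) by
    have : 1 / t * dist x z ^ 2 = dist x z ^ 2 / t := by ring
    linarith
  by_cases hzt : r + t * (R + r) + η ≤ dist z x₀
  · rw [indicator_of_mem (show z ∈ {z | r + t * (R + r) + η ≤ dist z x₀} from hzt)]
    refine sq_add_sq_le_sq_div_add_sq_div ht0 ht1 dist_nonneg hη (dist_triangle x z y)
      ?_
    have := dist_triangle_left z x₀ x
    have := mul_le_mul_of_nonneg_left hxy ht0.le
    linarith
  · rw [indicator_of_notMem (show z ∉ {z | r + t * (R + r) + η ≤ dist z x₀} from hzt), add_zero]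
    exact add_sq_le_sq_div_add_sq_div ht0 ht1 dist_nonneg (dist_triangle x z y)

theorem exists_discrete_small_fibers.{u} {X : Type u} [MetricSpace X] [MeasurableSpace X]
    [BorelSpace X] {ε : ℝ} (hε : 0 < ε) :
    ∃ (I : Type u) (_ : MeasurableSpace I) (_ : DiscreteMeasurableSpace I) (p : X → I),
      Measurable p ∧ ∀ x y, p x = p y → dist x y ≤ ε := by
  obtain ⟨p, hp, hdist⟩ := exists_small_fibers_forall_measurableSet (X := X) (half_pos hε)
  refine ⟨X, ⊤, @DiscreteMeasurableSpace.mk X ⊤ fun _ => trivial, p, fun J _ => hp J,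
    fun x y hxy => ?_⟩
  have h1 := hdist x
  have h2 := hdist y
  rw [hxy] at h1
  linarith [dist_triangle_right x y (p y)]

/-- Almost optimal couplings, together with a measurable minorant of the cost. -/
theorem exists_coupling_of_transportCost_lt {X : Type*} [MeasurableSpace X] [PseudoEMetricSpace X]
    {μ ν : Measure X} [IsProbabilityMeasure μ] {c : ENNReal} (h : transportCost μ ν < c)
    {ε : ENNReal} (hε : ε ≠ 0) :
    ∃ P : Measure (X × X), IsProbabilityMeasure P ∧ P.map Prod.fst = μ ∧ P.map Prod.snd = ν ∧
      ∃ g : X × X → ENNReal, Measurable g ∧ ∫⁻ w, g w ∂P ≤ c ∧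
        P {w | edist w.1 w.2 ^ 2 ≤ g w + ε} = 1 := by
  obtain ⟨⟨P, hP1, hP2⟩, hlt⟩ := iInf_lt_iff.1 h
  have hP : IsProbabilityMeasure P :=
    ⟨by rw [← preimage_univ (f := Prod.fst), ← Measure.map_apply measurable_fst MeasurableSet.univ,
      hP1, measure_univ]⟩
  obtain ⟨g, hg, -, heq, hfull⟩ := exists_measurable_minorant_full (P := P)
    (f := fun w => edist w.1 w.2 ^ 2) hlt.ne_top hε
  exact ⟨P, hP, hP1, hP2, g, hg, heq.trans_le hlt.le, hfull⟩

theorem transportCost_ne_top {X : Type*} [MetricSpace X] [MeasurableSpace X] [BorelSpace X]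
    {μ ν : Measure X} [IsProbabilityMeasure μ] [IsProbabilityMeasure ν] {x₀ : X} {r R : ℝ}
    (hμ : μ (ball x₀ r)ᶜ = 0) (hν : ν (ball x₀ R)ᶜ = 0) : transportCost μ ν ≠ ⊤ := by
  have h1 : ∀ᵐ w ∂(μ.prod ν), w.1 ∈ ball x₀ r :=
    Measure.quasiMeasurePreserving_fst.ae (p := fun x => x ∈ ball x₀ r) hμ
  have h2 : ∀ᵐ w ∂(μ.prod ν), w.2 ∈ ball x₀ R :=
    Measure.quasiMeasurePreserving_snd.ae (p := fun x => x ∈ ball x₀ R) hν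
  refine ne_top_of_le_ne_top (b := ENNReal.ofReal ((r + R) ^ 2)) ENNReal.ofReal_ne_top ?_
  refine (iInf_le _ ⟨μ.prod ν, by simp, by simp⟩).trans ?_
  calc ∫⁻ w, edist w.1 w.2 ^ 2 ∂(μ.prod ν)
      ≤ ∫⁻ _, ENNReal.ofReal ((r + R) ^ 2) ∂(μ.prod ν) := by
        refine lintegral_mono_ae ?_
        filter_upwards [h1, h2] with w hw1 hw2
        rw [mem_ball] at hw1 hw2
        rw [edist_dist, ← ENNReal.ofReal_pow dist_nonneg]
        refine ENNReal.ofReal_le_ofReal (pow_le_pow_left₀ dist_nonneg ?_ 2)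
        linarith [dist_triangle_right w.1 w.2 x₀]
    _ = ENNReal.ofReal ((r + R) ^ 2) := by simp

theorem transportCost_add_mul_measure_le {X : Type*} [MetricSpace X] [MeasurableSpace X]
    [BorelSpace X] {μ₀ μ μ₁ : Measure X} [IsProbabilityMeasure μ₀] [IsProbabilityMeasure μ]
    {x₀ : X} {r R t η ε : ℝ} (ht0 : 0 < t) (ht1 : t < 1)
    (hη : 0 ≤ η) (hε : 0 < ε) (h0 : μ₀ (ball x₀ r)ᶜ = 0) (h1 : μ₁ (ball x₀ R)ᶜ = 0)
    {c₁ c₂ : ENNReal} (hc₁ : transportCost μ₀ μ < c₁) (hc₂ : transportCost μ μ₁ < c₂) :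
    transportCost μ₀ μ₁ + ENNReal.ofReal (η ^ 2) * μ {z | r + t * (R + r) + η ≤ dist z x₀} ≤
      ENNReal.ofReal (1 / t) * (c₁ + ENNReal.ofReal ε) +
        ENNReal.ofReal ((1 + ε) / (1 - t)) * (c₂ + ENNReal.ofReal ε) +
        ENNReal.ofReal (ε * (1 + ε) / (1 - t)) := by
  have hε' : ENNReal.ofReal ε ≠ 0 := (ENNReal.ofReal_pos.2 hε).ne'
  have h1t : 0 < 1 - t := by linarith
  obtain ⟨P₁, hP₁, hP₁f, hP₁s, g₁, hg₁, hg₁c, hfull₁⟩ := exists_coupling_of_transportCost_lt hc₁ hε'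
  obtain ⟨P₂, hP₂, hP₂f, hP₂s, g₂, hg₂, hg₂c, hfull₂⟩ := exists_coupling_of_transportCost_lt hc₂ hε'
  obtain ⟨I, _, _, p, hp, hpdist⟩ := exists_discrete_small_fibers (X := X) hε
  have hU : P₁.map (p ∘ Prod.snd) = P₂.map (p ∘ Prod.fst) := by
    rw [← Measure.map_map hp measurable_snd, ← Measure.map_map hp measurable_fst, hP₁s, hP₂f]
  obtain ⟨Γ, hΓ, hΓf, hΓs, hae⟩ := exists_gluing P₁ P₂ (hp.comp measurable_snd)
    (hp.comp measurable_fst) hU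
  set A : Set X := {z | r + t * (R + r) + η ≤ dist z x₀}
  have hA : MeasurableSet A :=
    (isClosed_le continuous_const (continuous_id.dist continuous_const)).measurableSet
  let π : Measure (X × X) := Γ.map fun w => (w.1.1, w.2.2)
  have hm : Measurable fun w : (X × X) × (X × X) => (w.1.1, w.2.2) := by fun_prop
  have hπf : π.map Prod.fst = μ₀ := by
    rw [← hP₁f, ← hΓf, Measure.map_map measurable_fst hm,
      Measure.map_map measurable_fst measurable_fst]
    rfl
  have hπs : π.map Prod.snd = μ₁ := by
    rw [← hP₂s, ← hΓs, Measure.map_map measurable_snd hm,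
      Measure.map_map measurable_snd measurable_snd]
    rfl
  obtain ⟨h, hh, hhle, hheq⟩ := exists_measurable_le_lintegral_eq π fun w => edist w.1 w.2 ^ 2
  have hball₁ : P₁ (Prod.fst ⁻¹' ball x₀ r)ᶜ = 0 := by
    rw [← preimage_compl, ← Measure.map_apply measurable_fst measurableSet_ball.compl, hP₁f, h0]
  have hball₂ : P₂ (Prod.snd ⁻¹' ball x₀ R)ᶜ = 0 := by
    rw [← preimage_compl, ← Measure.map_apply measurable_snd measurableSet_ball.compl, hP₂s, h1]
  have hO₁ :
      P₁ ({w | edist w.1 w.2 ^ 2 ≤ g₁ w + ENNReal.ofReal ε} ∩ Prod.fst ⁻¹' ball x₀ r) = 1 := by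
    rw [measure_inter_conull hball₁, hfull₁]
  have hO₂ :
      P₂ ({w | edist w.1 w.2 ^ 2 ≤ g₂ w + ENNReal.ofReal ε} ∩ Prod.snd ⁻¹' ball x₀ R) = 1 := by
    rw [measure_inter_conull hball₂, hfull₂]
  have hind : Measurable fun w : (X × X) × (X × X) =>
      A.indicator (fun _ => ENNReal.ofReal (η ^ 2)) w.1.2 :=
    (measurable_const.indicator hA).comp (measurable_snd.comp measurable_fst)
  have hright : Measurable fun w : (X × X) × (X × X) =>
      ENNReal.ofReal (1 / t) * (g₁ w.1 + ENNReal.ofReal ε) +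
        ENNReal.ofReal ((1 + ε) / (1 - t)) * (g₂ w.2 + ENNReal.ofReal ε) +
        ENNReal.ofReal (ε * (1 + ε) / (1 - t)) := by fun_prop
  have hle : ∀ᵐ w ∂Γ, h (w.1.1, w.2.2) + A.indicator (fun _ => ENNReal.ofReal (η ^ 2)) w.1.2 ≤
      ENNReal.ofReal (1 / t) * (g₁ w.1 + ENNReal.ofReal ε) +
        ENNReal.ofReal ((1 + ε) / (1 - t)) * (g₂ w.2 + ENNReal.ofReal ε) +
        ENNReal.ofReal (ε * (1 + ε) / (1 - t)) := by
    refine hae _ _ hO₁ hO₂ _ (measurableSet_le ((hh.comp hm).add hind) hright) ?_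
    rintro ⟨x, z⟩ ⟨hw, hx⟩ ⟨z', y⟩ ⟨hw', hy⟩ hzz
    have hreal := sq_dist_add_indicator_le (z := z) (z' := z') ht0 ht1 hη hε.le hx hy
      (hpdist z z' hzz)
    have hofReal : A.indicator (fun _ => ENNReal.ofReal (η ^ 2)) z =
        ENNReal.ofReal (A.indicator (fun _ => η ^ 2) z) := by
      by_cases hzA : z ∈ A <;> simp [hzA]
    have hpos : 0 ≤ A.indicator (fun _ => η ^ 2) z := indicator_nonneg (fun _ _ => sq_nonneg η) z
    have hxz : ENNReal.ofReal (dist x z ^ 2) ≤ g₁ (x, z) + ENNReal.ofReal ε := by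
      rw [ENNReal.ofReal_pow dist_nonneg, ← edist_dist]
      exact hw
    have hzy : ENNReal.ofReal (dist z' y ^ 2) ≤ g₂ (z', y) + ENNReal.ofReal ε := by
      rw [ENNReal.ofReal_pow dist_nonneg, ← edist_dist]
      exact hw'
    have hxy : h (x, y) ≤ ENNReal.ofReal (dist x y ^ 2) := by
      rw [ENNReal.ofReal_pow dist_nonneg, ← edist_dist]
      exact hhle (x, y)
    calc h (x, y) + A.indicator (fun _ => ENNReal.ofReal (η ^ 2)) z
        ≤ ENNReal.ofReal (dist x y ^ 2) + ENNReal.ofReal (A.indicator (fun _ => η ^ 2) z) := by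
          rw [hofReal]
          gcongr
      _ = ENNReal.ofReal (dist x y ^ 2 + A.indicator (fun _ => η ^ 2) z) :=
          (ENNReal.ofReal_add (sq_nonneg _) hpos).symm
      _ ≤ _ := ENNReal.ofReal_le_ofReal hreal
      _ = ENNReal.ofReal (1 / t) * ENNReal.ofReal (dist x z ^ 2) +
          ENNReal.ofReal ((1 + ε) / (1 - t)) * ENNReal.ofReal (dist z' y ^ 2) +
          ENNReal.ofReal (ε * (1 + ε) / (1 - t)) := by
          rw [ENNReal.ofReal_add (by positivity) (by positivity),
            ENNReal.ofReal_add (by positivity) (by positivity), ENNReal.ofReal_mul (by positivity),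
            ENNReal.ofReal_mul (by positivity)]
      _ ≤ _ := by gcongr
  have hintg := lintegral_mono_ae hle
  have hleft : ∫⁻ w, h (w.1.1, w.2.2) + A.indicator (fun _ => ENNReal.ofReal (η ^ 2)) w.1.2 ∂Γ =
      ∫⁻ w, edist w.1 w.2 ^ 2 ∂π + ENNReal.ofReal (η ^ 2) * μ A := by
    rw [lintegral_add_right _ hind, hheq, lintegral_map hh hm, ← hP₁s, ← hΓf,
      Measure.map_map measurable_snd measurable_fst, ← lintegral_indicator_const hA,
      lintegral_map (measurable_const.indicator hA) (measurable_snd.comp measurable_fst)]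
    rfl
  have hg₁' : ∫⁻ w, g₁ w.1 ∂Γ = ∫⁻ w, g₁ w ∂P₁ := by rw [← hΓf, lintegral_map hg₁ measurable_fst]
  have hg₂' : ∫⁻ w, g₂ w.2 ∂Γ = ∫⁻ w, g₂ w ∂P₂ := by rw [← hΓs, lintegral_map hg₂ measurable_snd]
  rw [hleft, lintegral_add_right _ measurable_const, lintegral_add_left (by fun_prop),
    lintegral_const_mul _ (by fun_prop), lintegral_const_mul _ (by fun_prop),
    lintegral_add_right _ measurable_const, lintegral_add_right _ measurable_const, hg₁', hg₂',
    lintegral_const, lintegral_const, measure_univ, mul_one, mul_one] at hintg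
  calc transportCost μ₀ μ₁ + ENNReal.ofReal (η ^ 2) * μ A
      ≤ ∫⁻ w, edist w.1 w.2 ^ 2 ∂π + ENNReal.ofReal (η ^ 2) * μ A := by
        gcongr
        exact iInf_le (fun π : {π : Measure (X × X) // π.map Prod.fst = μ₀ ∧ π.map Prod.snd = μ₁} =>
          ∫⁻ p, edist p.1 p.2 ^ 2 ∂(π : Measure (X × X))) ⟨π, hπf, hπs⟩
    _ ≤ _ := hintg
    _ ≤ _ := by gcongr

theorem wassersteinDist_sq_s1 {X : Type*} [MeasurableSpace X] [PseudoEMetricSpace X]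
    (μ ν : Measure X) : wassersteinDist μ ν ^ 2 = transportCost μ ν := by
  rw [wassersteinDist, ← ENNReal.rpow_natCast, ← ENNReal.rpow_mul]
  norm_num
  rfl

/-- The `t`-intermediate measures between measures concentrated on balls of radii `r` and `R` are
concentrated on the ball of radius `r + t (R + r) + η`. -/
theorem measure_setOf_le_dist_eq_zero {X : Type*} [MetricSpace X] [MeasurableSpace X]
    [BorelSpace X] {μ₀ μ μ₁ : Measure X} [IsProbabilityMeasure μ₀] [IsProbabilityMeasure μ]
    [IsProbabilityMeasure μ₁] {x₀ : X} {r R t η : ℝ} (ht0 : 0 < t) (ht1 : t < 1)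
    (hη : 0 < η) (h0 : μ₀ (ball x₀ r)ᶜ = 0) (h1 : μ₁ (ball x₀ R)ᶜ = 0)
    (hc₁ : transportCost μ₀ μ = ENNReal.ofReal (t ^ 2) * transportCost μ₀ μ₁)
    (hc₂ : transportCost μ μ₁ = ENNReal.ofReal ((1 - t) ^ 2) * transportCost μ₀ μ₁) :
    μ {z | r + t * (R + r) + η ≤ dist z x₀} = 0 := by
  have h1t : 0 < 1 - t := by linarith
  set A : Set X := {z | r + t * (R + r) + η ≤ dist z x₀} with hA
  set c := (transportCost μ₀ μ₁).toReal with hc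
  have hcc : transportCost μ₀ μ₁ = ENNReal.ofReal c :=
    (ENNReal.ofReal_toReal (transportCost_ne_top h0 h1)).symm
  have hc0 : 0 ≤ c := ENNReal.toReal_nonneg
  set p := (μ A).toReal
  have hpp : μ A = ENNReal.ofReal p := (ENNReal.ofReal_toReal (measure_ne_top _ _)).symm
  have hp0 : 0 ≤ p := ENNReal.toReal_nonneg
  let F : ℝ → ℝ := fun ε => 1 / t * (t ^ 2 * c + ε + ε) +
    (1 + ε) / (1 - t) * ((1 - t) ^ 2 * c + ε + ε) + ε * (1 + ε) / (1 - t)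
  have hF (ε : ℝ) (hε : 0 < ε) : c + η ^ 2 * p ≤ F ε := by
    have h := transportCost_add_mul_measure_le (μ₀ := μ₀) (μ := μ) (μ₁ := μ₁)
      (c₁ := ENNReal.ofReal (t ^ 2 * c + ε)) (c₂ := ENNReal.ofReal ((1 - t) ^ 2 * c + ε))
      ht0 ht1 hη.le hε h0 h1
      (by rw [hc₁, hcc, ← ENNReal.ofReal_mul (by positivity)]
          exact (ENNReal.ofReal_lt_ofReal_iff (by positivity)).2 (by linarith))
      (by rw [hc₂, hcc, ← ENNReal.ofReal_mul (by positivity)]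
          exact (ENNReal.ofReal_lt_ofReal_iff (by positivity)).2 (by linarith))
    rw [← hA, hcc, hpp, ← ENNReal.ofReal_mul (by positivity),
      ← ENNReal.ofReal_add (by positivity) (by positivity),
      ← ENNReal.ofReal_add (by positivity) (by positivity),
      ← ENNReal.ofReal_add (by positivity) (by positivity),
      ← ENNReal.ofReal_mul (by positivity), ← ENNReal.ofReal_mul (by positivity),
      ← ENNReal.ofReal_add (by positivity) (by positivity),
      ← ENNReal.ofReal_add (by positivity) (by positivity)] at h
    exact (ENNReal.ofReal_le_ofReal_iff (by positivity)).1 h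
  have hcont : Continuous F := by fun_prop
  have hlim : Tendsto F (nhdsWithin 0 (Ioi 0)) (nhds (F 0)) :=
    hcont.continuousAt.tendsto.mono_left nhdsWithin_le_nhds
  have hF0 : F 0 = c := by
    simp only [F]
    field_simp
    ring
  have hle : c + η ^ 2 * p ≤ c := by
    rw [← hF0]
    refine ge_of_tendsto hlim ?_
    rw [hF0]
    filter_upwards [self_mem_nhdsWithin] with ε hε using hF ε hε
  have : p = 0 := by nlinarith [pow_pos hη 2]
  rw [hpp, this, ENNReal.ofReal_zero]

theorem sigmaFinite_of_measure_ball_ne_top {X : Type*} [MetricSpace X] [MeasurableSpace X]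
    {m : Measure X} (x₀ : X) (h : ∀ r : ℝ, 0 < r → m (ball x₀ r) ≠ ⊤) : SigmaFinite m :=
  ⟨⟨{ set := fun n => ball x₀ (n + 1)
      set_mem := fun _ => trivial
      finite := fun n => (h _ (by positivity)).lt_top
      spanning := by
        refine eq_univ_of_forall fun x => ?_
        obtain ⟨n, hn⟩ := exists_nat_gt (dist x x₀)
        exact mem_iUnion.2 ⟨n, by rw [mem_ball]; linarith⟩ }⟩⟩

theorem mul_log_add_sub_le {a c : ℝ} (ha : 0 ≤ a) (hc : 0 < c) :
    a * Real.log c + a - c ≤ a * Real.log a := by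
  rcases ha.eq_or_lt with rfl | ha
  · simpa using hc.le
  have h := Real.log_le_sub_one_of_pos (div_pos hc ha)
  rw [Real.log_div hc.ne' ha.ne'] at h
  have h2 := mul_le_mul_of_nonneg_left h ha.le
  have h3 : a * (c / a - 1) = c - a := by field_simp
  linarith

/-- Jensen's inequality for the entropy of a measure concentrated on a set of finite mass. -/
theorem neg_log_measure_le_relEntropy {X : Type*} [MeasurableSpace X] {m μ : Measure X}
    [SigmaFinite m] [IsProbabilityMeasure μ] {B : Set X} (hB : MeasurableSet B)
    (hmB : m B ≠ ⊤) (hμB : μ Bᶜ = 0) :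
    ((-Real.log (m B).toReal : ℝ) : EReal) ≤ relEntropy m μ := by
  rw [relEntropy]
  split_ifs with h
  swap
  · exact le_top
  obtain ⟨hac, hintg⟩ := h
  rw [EReal.coe_le_coe_iff]
  have hmB0 : m B ≠ 0 := fun h0 => by
    have := (prob_compl_eq_zero_iff hB).1 hμB
    rw [hac h0] at this
    exact zero_ne_one this
  have hpos : 0 < (m B).toReal := ENNReal.toReal_pos hmB0 hmB
  set c := (m B).toReal⁻¹
  have hc : 0 < c := inv_pos.2 hpos
  have hρint : Integrable (fun x => (μ.rnDeriv m x).toReal) m := Measure.integrable_toReal_rnDeriv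
  have hρ1 : ∫ x, (μ.rnDeriv m x).toReal ∂m = 1 := by
    rw [Measure.integral_toReal_rnDeriv hac]
    simp
  have hzero : ∀ᵐ x ∂m, x ∈ Bᶜ → μ.rnDeriv m x = 0 := by
    have := Measure.setLIntegral_rnDeriv hac Bᶜ
    rw [hμB, lintegral_eq_zero_iff (Measure.measurable_rnDeriv _ _)] at this
    exact (ae_restrict_iff' hB.compl).1 this
  have hBint : Integrable (B.indicator fun _ => c) m :=
    (integrable_indicator_iff hB).2 (integrableOn_const hmB)
  have hle : ∀ᵐ x ∂m, (μ.rnDeriv m x).toReal * Real.log c + (μ.rnDeriv m x).toReal -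
      B.indicator (fun _ => c) x ≤ (μ.rnDeriv m x).toReal * Real.log (μ.rnDeriv m x).toReal := by
    filter_upwards [hzero] with x hx
    by_cases hxB : x ∈ B
    · rw [indicator_of_mem hxB]
      exact mul_log_add_sub_le ENNReal.toReal_nonneg hc
    · simp [hxB, hx hxB]
  have hfin := integral_mono_ae (((hρint.mul_const _).add hρint).sub hBint) hintg hle
  refine le_trans (le_of_eq ?_) hfin
  rw [integral_sub' ((hρint.mul_const _).add hρint) hBint, integral_add' (hρint.mul_const _) hρint,
    integral_mul_const, hρ1, integral_indicator_const _ hB, Measure.real, smul_eq_mul,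
    mul_inv_cancel₀ hpos.ne', Real.log_inv]
  ring

theorem relEntropy_cond {X : Type*} [MeasurableSpace X] {m : Measure X} [SigmaFinite m]
    {A : Set X} (hA : MeasurableSet A) (h0 : m A ≠ 0) (hfin : m A ≠ ⊤) :
    relEntropy m (ProbabilityTheory.cond m A) = ((-Real.log (m A).toReal : ℝ) : EReal) := by
  have hpos : 0 < (m A).toReal := ENNReal.toReal_pos h0 hfin
  have hwd : ProbabilityTheory.cond m A = m.withDensity (A.indicator fun _ => (m A)⁻¹) := by
    rw [withDensity_indicator hA, withDensity_const, ProbabilityTheory.cond]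
  have hrn : (ProbabilityTheory.cond m A).rnDeriv m =ᵐ[m] A.indicator fun _ => (m A)⁻¹ := by
    rw [hwd]
    exact Measure.rnDeriv_withDensity _ (measurable_const.indicator hA)
  have heq : (fun x => ((ProbabilityTheory.cond m A).rnDeriv m x).toReal *
        Real.log ((ProbabilityTheory.cond m A).rnDeriv m x).toReal)
      =ᵐ[m] A.indicator fun _ => (m A).toReal⁻¹ * Real.log (m A).toReal⁻¹ := by
    filter_upwards [hrn] with x hx
    rw [hx]
    by_cases hxA : x ∈ A <;> simp [hxA]
  have hintg : Integrable (A.indicator fun _ => (m A).toReal⁻¹ * Real.log (m A).toReal⁻¹) m :=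
    (integrable_indicator_iff hA).2 (integrableOn_const hfin)
  rw [relEntropy,
    if_pos ⟨ProbabilityTheory.cond_absolutelyContinuous, (integrable_congr heq).2 hintg⟩,
    integral_congr_ae heq, integral_indicator_const _ hA, Measure.real, smul_eq_mul, ← mul_assoc,
    mul_inv_cancel₀ hpos.ne', one_mul, Real.log_inv]

open ProbabilityTheory in
theorem lintegral_edist_sq_cond_ball_ne_top {X : Type*} [MetricSpace X] [MeasurableSpace X]
    [BorelSpace X] {m : Measure X} (x₀ y : X) (r : ℝ)
    [IsProbabilityMeasure (ProbabilityTheory.cond m (ball x₀ r))] :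
    ∫⁻ x, edist x y ^ 2 ∂(ProbabilityTheory.cond m (ball x₀ r)) ≠ ⊤ := by
  refine ne_top_of_le_ne_top (b := ENNReal.ofReal ((r + dist x₀ y) ^ 2)) ENNReal.ofReal_ne_top ?_
  calc ∫⁻ x, edist x y ^ 2 ∂(ProbabilityTheory.cond m (ball x₀ r))
      ≤ ∫⁻ _, ENNReal.ofReal ((r + dist x₀ y) ^ 2) ∂(ProbabilityTheory.cond m (ball x₀ r)) := by
        refine lintegral_mono_ae ?_
        filter_upwards [ae_cond_mem measurableSet_ball] with x hx
        rw [mem_ball] at hx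
        rw [edist_dist, ← ENNReal.ofReal_pow dist_nonneg]
        refine ENNReal.ofReal_le_ofReal (pow_le_pow_left₀ dist_nonneg ?_ 2)
        linarith [dist_triangle x x₀ y]
    _ = ENNReal.ofReal ((r + dist x₀ y) ^ 2) := by simp

/-- Brunn–Minkowski type inequality for concentric balls. -/
theorem log_measure_ball_ge {X : Type*} [MetricSpace X] [MeasurableSpace X] [BorelSpace X]
    {m : Measure X} (hCD : IsCD0Infty m) (hball : ∀ (x : X) (r : ℝ), 0 < r → m (ball x r) ≠ ⊤)
    {x₀ : X} {r R t η : ℝ} (hr : 0 < r) (hR : 0 < R) (hmr : m (ball x₀ r) ≠ 0)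
    (hmR : m (ball x₀ R) ≠ 0) (ht0 : 0 < t) (ht1 : t < 1) (hη : 0 < η) :
    (1 - t) * Real.log (m (ball x₀ r)).toReal + t * Real.log (m (ball x₀ R)).toReal ≤
      Real.log (m (ball x₀ (r + t * (R + r) + η))).toReal := by
  have hσ : SigmaFinite m := sigmaFinite_of_measure_ball_ne_top x₀ (hball x₀)
  set μ₀ := ProbabilityTheory.cond m (ball x₀ r) with hμ₀
  set μ₁ := ProbabilityTheory.cond m (ball x₀ R) with hμ₁
  have hp₀ : IsProbabilityMeasure μ₀ :=
    ProbabilityTheory.cond_isProbabilityMeasure_of_finite hmr (hball _ _ hr)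
  have hp₁ : IsProbabilityMeasure μ₁ :=
    ProbabilityTheory.cond_isProbabilityMeasure_of_finite hmR (hball _ _ hR)
  have hs₀ : μ₀ (ball x₀ r)ᶜ = 0 := ProbabilityTheory.ae_cond_mem measurableSet_ball
  have hs₁ : μ₁ (ball x₀ R)ᶜ = 0 := ProbabilityTheory.ae_cond_mem measurableSet_ball
  obtain ⟨μ, hμ0, hμ1, hprob, hW, hEnt⟩ := hCD μ₀ μ₁ hp₀ hp₁
    ProbabilityTheory.cond_absolutelyContinuous ProbabilityTheory.cond_absolutelyContinuous
    (fun y => lintegral_edist_sq_cond_ball_ne_top x₀ y r)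
    (fun y => lintegral_edist_sq_cond_ball_ne_top x₀ y R)
  have ht : t ∈ Icc (0 : ℝ) 1 := ⟨ht0.le, ht1.le⟩
  have hpt := hprob t ht
  have hcost (s u : ℝ) (hs : s ∈ Icc (0 : ℝ) 1) (hu : u ∈ Icc (0 : ℝ) 1) :
      transportCost (μ s) (μ u) = ENNReal.ofReal ((s - u) ^ 2) * transportCost μ₀ μ₁ := by
    rw [← wassersteinDist_sq_s1, hW s hs u hu, mul_pow, wassersteinDist_sq_s1,
      ← ENNReal.ofReal_pow (abs_nonneg _), sq_abs]
  have hc₁ : transportCost μ₀ (μ t) = ENNReal.ofReal (t ^ 2) * transportCost μ₀ μ₁ := by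
    have h := hcost 0 t ⟨le_rfl, zero_le_one⟩ ht
    rwa [hμ0, zero_sub, neg_sq] at h
  have hc₂ : transportCost (μ t) μ₁ = ENNReal.ofReal ((1 - t) ^ 2) * transportCost μ₀ μ₁ := by
    have h := hcost t 1 ht ⟨zero_le_one, le_rfl⟩
    rwa [hμ1, ← neg_sub, neg_sq] at h
  have htail := measure_setOf_le_dist_eq_zero ht0 ht1 hη hs₀ hs₁ hc₁ hc₂
  have hcompl : (ball x₀ (r + t * (R + r) + η))ᶜ = {z | r + t * (R + r) + η ≤ dist z x₀} := by
    ext z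
    simp
  have h := (neg_log_measure_le_relEntropy (μ := μ t) measurableSet_ball
    (hball x₀ (r + t * (R + r) + η) (by positivity)) (hcompl ▸ htail)).trans (hEnt t ht)
  rw [hμ₀, hμ₁, relEntropy_cond measurableSet_ball hmr (hball _ _ hr),
    relEntropy_cond measurableSet_ball hmR (hball _ _ hR)] at h
  norm_cast at h
  linarith

/-- A function on the half-line with the weak superlinearity property satisfied by the logarithm of
the volume of balls has a (possibly infinite) asymptotic slope. -/
theorem exists_tendsto_div_of_interpolation {f : ℝ → ℝ} {r : ℝ}
    (hmono : ∀ R, r ≤ R → f r ≤ f R)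
    (hf : ∀ R, r ≤ R → ∀ t : ℝ, 0 < t → t < 1 →
      (1 - t) * f r + t * f R ≤ f (r + t * (R + r) + 1)) :
    ∃ L : EReal, 0 ≤ L ∧ Tendsto (fun R : ℝ => ((f R / R : ℝ) : EReal)) atTop (nhds L) := by
  set F : ℝ → EReal := fun R => ((f R / R : ℝ) : EReal)
  have key : limsup F atTop ≤ liminf F atTop := by
    refine le_of_forall_lt fun c hc => ?_
    obtain ⟨a, hca, haL⟩ := EReal.lt_iff_exists_real_btwn.1 hc
    refine hca.trans_le ?_
    have hfreq : ∃ᶠ R in atTop, a < f R / R :=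
      (frequently_lt_of_lt_limsup (by isBoundedDefault) haL).mono fun R hR =>
        EReal.coe_lt_coe_iff.1 hR
    have hlow : ∀ u, r + 1 < u → -|f r| + a * (u - r - 1) ≤ f u := by
      intro u hu
      have hlim : Tendsto (fun R : ℝ => -|f r| + a * (u - r - 1) * (R / (R + r))) atTop
          (nhds (-|f r| + a * (u - r - 1) * 1)) := by
        have h1 : Tendsto (fun R : ℝ => 1 - r / (R + r)) atTop (nhds (1 - 0)) :=
          tendsto_const_nhds.sub (tendsto_const_nhds.div_atTop
            (tendsto_atTop_add_const_right _ _ tendsto_id))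
        rw [sub_zero] at h1
        refine tendsto_const_nhds.add (tendsto_const_nhds.mul (h1.congr' ?_))
        filter_upwards [eventually_gt_atTop (-r)] with R hR
        have : R + r ≠ 0 := by linarith
        field_simp
        ring
      rw [mul_one] at hlim
      refine le_of_tendsto_of_frequently hlim ?_
      refine (hfreq.and_eventually ((eventually_gt_atTop (u + 2 * |r|)).and
        ((eventually_ge_atTop r).and (eventually_gt_atTop 0)))).mono ?_
      rintro R ⟨haR, hRu, hRr, hR0⟩
      have hra := neg_abs_le r
      have hra' := le_abs_self r
      have hRr' : 0 < R + r := by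
        linarith
      set t := (u - r - 1) / (R + r) with ht
      have ht0 : 0 < t := div_pos (by linarith) hRr'
      have ht1 : t < 1 := by
        rw [ht, div_lt_one hRr']
        linarith
      have h := hf R hRr t ht0 ht1
      have hu' : r + t * (R + r) + 1 = u := by
        rw [ht, div_mul_cancel₀ _ hRr'.ne']
        ring
      rw [hu'] at h
      have haR' : a * R < f R := (lt_div_iff₀ hR0).1 haR
      have h1 : -|f r| ≤ (1 - t) * f r := by
        have h2 := neg_abs_le (f r)
        have h3 := abs_nonneg (f r)
        nlinarith
      have h2 : a * (u - r - 1) * (R / (R + r)) = t * (a * R) := by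
        rw [ht]
        ring
      rw [h2]
      nlinarith
    have hlim : Tendsto (fun u : ℝ => ((a + (-|f r| - a * (r + 1)) / u : ℝ) : EReal)) atTop
        (nhds (a : EReal)) := by
      refine (continuous_coe_real_ereal.tendsto a).comp ?_
      have h1 : Tendsto (fun u : ℝ => (-|f r| - a * (r + 1)) / u) atTop (nhds 0) :=
        tendsto_const_nhds.div_atTop tendsto_id
      simpa using tendsto_const_nhds.add h1
    rw [← hlim.liminf_eq]
    refine liminf_le_liminf ?_
    filter_upwards [eventually_gt_atTop (r + 1), eventually_gt_atTop 0] with u hu hu0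
    rw [EReal.coe_le_coe_iff, le_div_iff₀ hu0, add_mul, div_mul_cancel₀ _ hu0.ne']
    linarith [hlow u hu]
  refine ⟨limsup F atTop, ?_, tendsto_of_le_liminf_of_limsup_le key le_rfl⟩
  have h0 : Tendsto (fun u : ℝ => ((f r / u : ℝ) : EReal)) atTop (nhds ((0 : ℝ) : EReal)) :=
    (continuous_coe_real_ereal.tendsto 0).comp (tendsto_const_nhds.div_atTop tendsto_id)
  rw [← EReal.coe_zero, ← h0.limsup_eq]
  refine limsup_le_limsup ?_
  filter_upwards [eventually_ge_atTop r, eventually_gt_atTop 0] with u hu hu0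
  rw [EReal.coe_le_coe_iff]
  exact div_le_div_of_nonneg_right (hmono u hu) hu0.le

theorem le_of_tendsto_div_of_shift_le {f g : ℝ → ℝ} {d : ℝ} {L L' : EReal}
    (hf : Tendsto (fun R : ℝ => ((f R / R : ℝ) : EReal)) atTop (nhds L))
    (hg : Tendsto (fun R : ℝ => ((g R / R : ℝ) : EReal)) atTop (nhds L'))
    (h : ∀ᶠ R in atTop, f (R - d) ≤ g R) : L ≤ L' := by
  refine le_of_forall_lt fun c hc => ?_
  obtain ⟨a, hca, haL⟩ := EReal.lt_iff_exists_real_btwn.1 hc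
  refine hca.trans_le ?_
  have hlim : Tendsto (fun R : ℝ => ((a - a * d / R : ℝ) : EReal)) atTop (nhds (a : EReal)) := by
    refine (continuous_coe_real_ereal.tendsto a).comp ?_
    have h1 : Tendsto (fun R : ℝ => a * d / R) atTop (nhds 0) :=
      tendsto_const_nhds.div_atTop tendsto_id
    simpa using tendsto_const_nhds.sub h1
  refine le_of_tendsto_of_tendsto hlim hg ?_
  have hshift : Tendsto (fun R : ℝ => R - d) atTop atTop :=
    tendsto_atTop_add_const_right _ (-d) tendsto_id
  filter_upwards [h, hshift.eventually (hf.eventually_const_lt haL), eventually_gt_atTop 0,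
    eventually_gt_atTop d] with R h1 h2 h3 h4
  rw [EReal.coe_lt_coe_iff, lt_div_iff₀ (by linarith)] at h2
  rw [EReal.coe_le_coe_iff, le_div_iff₀ h3, sub_mul, div_mul_cancel₀ _ h3.ne']
  linarith

theorem log_toReal_mono {a b : ENNReal} (ha : a ≠ 0) (hb : b ≠ ⊤) (h : a ≤ b) :
    Real.log a.toReal ≤ Real.log b.toReal :=
  Real.log_le_log (ENNReal.toReal_pos ha (ne_top_of_le_ne_top hb h)) (ENNReal.toReal_mono hb h)

theorem exists_tendsto_log_measure_ball_div {X : Type*} [MetricSpace X] [MeasurableSpace X]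
    [BorelSpace X] {m : Measure X} (hCD : IsCD0Infty m)
    (hball : ∀ (x : X) (r : ℝ), 0 < r → m (ball x r) ≠ ⊤) (x₀ : X) :
    ∃ L : EReal, 0 ≤ L ∧ Tendsto (fun r : ℝ => ((Real.log (m (ball x₀ r)).toReal / r : ℝ) : EReal))
      atTop (nhds L) := by
  by_cases h : ∃ r, 0 < r ∧ m (ball x₀ r) ≠ 0
  · obtain ⟨r, hr, hmr⟩ := h
    refine exists_tendsto_div_of_interpolation (r := r)
      (f := fun R => Real.log (m (ball x₀ R)).toReal) (fun R hR => ?_) fun R hR t ht0 ht1 => ?_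
    · exact log_toReal_mono hmr (hball _ _ (hr.trans_le hR)) (measure_mono (ball_subset_ball hR))
    · refine log_measure_ball_ge hCD hball hr (hr.trans_le hR) hmr ?_ ht0 ht1 one_pos
      exact fun h0 => hmr (measure_mono_null (ball_subset_ball hR) h0)
  · push Not at h
    refine ⟨0, le_rfl, tendsto_const_nhds.congr' ?_⟩
    filter_upwards [eventually_gt_atTop 0] with r hr
    simp [h r hr]

theorem le_of_tendsto_log_measure_ball_div {X : Type*} [MetricSpace X] [MeasurableSpace X]
    {m : Measure X} (hball : ∀ (x : X) (r : ℝ), 0 < r → m (ball x r) ≠ ⊤) {x₀ x₁ : X}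
    {L L' : EReal}
    (h₀ : Tendsto (fun r : ℝ => ((Real.log (m (ball x₀ r)).toReal / r : ℝ) : EReal))
      atTop (nhds L))
    (h₁ : Tendsto (fun r : ℝ => ((Real.log (m (ball x₁ r)).toReal / r : ℝ) : EReal))
      atTop (nhds L')) : L ≤ L' := by
  refine le_of_tendsto_div_of_shift_le (f := fun r => Real.log (m (ball x₀ r)).toReal)
    (g := fun r => Real.log (m (ball x₁ r)).toReal) (d := dist x₀ x₁) h₀ h₁ ?_
  by_cases h : ∃ r, m (ball x₀ r) ≠ 0
  · obtain ⟨r, hmr⟩ := h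
    filter_upwards [eventually_ge_atTop (r + dist x₀ x₁), eventually_gt_atTop 0] with R hR hR0
    refine log_toReal_mono (fun h0 => hmr ?_) (hball _ _ hR0) (measure_mono (ball_subset (by simp)))
    exact measure_mono_null (ball_subset_ball (by linarith)) h0
  · push Not at h
    refine Eventually.of_forall fun R => ?_
    have h1 : m (ball x₁ R) = 0 := by
      refine measure_mono_null (ball_subset (x := x₁) (y := x₀) (ε₂ := R + dist x₁ x₀) ?_) (h _)
      simp
    simp [h, h1]

/-- under CD(0,∞), the volume entropy exists in `[0,∞]` and is
basepoint-independent. -/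
theorem volume_entropy_exists_basepoint_indep
    {X : Type*} [MetricSpace X] [MeasurableSpace X] [BorelSpace X]
    (m : Measure X) (hCD : IsCD0Infty m)
    (hball : ∀ (x : X) (r : ℝ), 0 < r → m (ball x r) ≠ ⊤) (x₀ : X) :
    ∃ L : EReal, 0 ≤ L ∧
      Tendsto (fun r : ℝ => ((Real.log (m (ball x₀ r)).toReal / r : ℝ) : EReal))
        atTop (nhds L) ∧
      ∀ x₁ : X, Tendsto (fun r : ℝ => ((Real.log (m (ball x₁ r)).toReal / r : ℝ) : EReal))
        atTop (nhds L) := by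
  obtain ⟨L, hL, hlim⟩ := exists_tendsto_log_measure_ball_div hCD hball x₀
  refine ⟨L, hL, hlim, fun x₁ => ?_⟩
  obtain ⟨L', -, hlim'⟩ := exists_tendsto_log_measure_ball_div hCD hball x₁
  rwa [le_antisymm (le_of_tendsto_log_measure_ball_div hball hlim hlim')
    (le_of_tendsto_log_measure_ball_div hball hlim' hlim)]
end
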